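/- arXiv:2112.14960 — 2 statements merged into one kernel-verified Lean document; each statement's English description precedes it below -/
import Mathlib

section
/- (Li–Ning) Let G be a bipartite graph with parts of sizes n and m, n ≥ m, and let C be a longest cycle of G with |V(C)| = 2c, where m ≥ c. If m ≥ 2c, then e(G − C) + e(G − C, C) ≤ c(m + n + 1 − 3c). -/
def hasCycleLength {V : Type*} (G : SimpleGraph V) (l : ℕ) : Prop :=
  ∃ (v : V) (p : G.Walk v v), p.IsCycle ∧ p.length = l

namespace LiNing

open Finset

variable {V : Type*}

/-- `f` runs periodically around a longest cycle of length `2 * c` in a graph properly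
two-coloured by `col`, with colour `true` at the even positions. -/
structure LongCycle (G : SimpleGraph V) (c : ℕ) (col : V → Bool) (f : ℤ → V) : Prop where
  two_le : 2 ≤ c
  bip : ∀ u v, G.Adj u v → col v = !col u
  adj : ∀ i, G.Adj (f i) (f (i + 1))
  inj : ∀ i j, f i = f j ↔ (2 * c : ℤ) ∣ i - j
  par : ∀ i, col (f i) = true ↔ Even i
  max : ∀ l : List V, l.Nodup → l.IsChain G.Adj →
    (∀ a ∈ l.head?, ∀ b ∈ l.getLast?, G.Adj b a) → l.length ≤ 2 * c

/-- A path avoiding the cycle whose first vertex is adjacent to `x` and whose last vertex is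
adjacent to `y`. -/
structure Ear (G : SimpleGraph V) (f : ℤ → V) (x y : V) (Q : List V) : Prop where
  ne : Q ≠ []
  nodup : Q.Nodup
  chain : Q.IsChain G.Adj
  out : ∀ a ∈ Q, a ∉ Set.range f
  head : ∀ a ∈ Q.head?, G.Adj x a
  last : ∀ a ∈ Q.getLast?, G.Adj a y

theorem Ear.reverse {G : SimpleGraph V} {f : ℤ → V} {x y : V} {Q : List V}
    (h : Ear G f x y Q) : Ear G f y x Q.reverse where
  ne := by simpa using h.ne
  nodup := by simpa using h.nodup
  chain := by
    rw [List.isChain_reverse]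
    exact h.chain.imp fun _ _ hab => hab.symm
  out := by simpa using h.out
  head := by simpa using fun a ha => (h.last a ha).symm
  last := by simpa using fun a ha => (h.head a ha).symm

theorem Ear.singleton {G : SimpleGraph V} {f : ℤ → V} {x y u : V}
    (hu : u ∉ Set.range f) (hx : G.Adj u x) (hy : G.Adj u y) : Ear G f x y [u] where
  ne := by simp
  nodup := by simp
  chain := by simp
  out := by simpa using hu
  head := by simpa using hx.symm
  last := by simpa using hy

/-- The segment of `n` consecutive vertices of the cycle starting at position `i`. -/
def arc (f : ℤ → V) (i : ℤ) (n : ℕ) : List V := (List.range n).map fun t : ℕ => f (i + t)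

@[simp] theorem length_arc (f : ℤ → V) (i : ℤ) (n : ℕ) : (arc f i n).length = n := by simp [arc]

theorem mem_arc {f : ℤ → V} {i : ℤ} {n : ℕ} {a : V} :
    a ∈ arc f i n ↔ ∃ t : ℕ, t < n ∧ f (i + t) = a := by simp [arc]

@[simp] theorem head?_arc (f : ℤ → V) (i : ℤ) (n : ℕ) : (arc f i (n + 1)).head? = some (f i) := by
  simp [arc, List.range_succ_eq_map]

@[simp] theorem getLast?_arc (f : ℤ → V) (i : ℤ) (n : ℕ) :
    (arc f i (n + 1)).getLast? = some (f (i + n)) := by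
  simp [arc, List.range_succ]

theorem mem_range_of_mem_arc {f : ℤ → V} {i : ℤ} {n : ℕ} {a : V} (h : a ∈ arc f i n) :
    a ∈ Set.range f := by
  obtain ⟨t, -, rfl⟩ := mem_arc.1 h
  exact ⟨_, rfl⟩

variable {G : SimpleGraph V} {c : ℕ} {col : V → Bool} {f : ℤ → V}

namespace LongCycle

theorem flip (h : LongCycle G c col f) :
    LongCycle G c (fun v => !col v) (fun i => f (i + 1)) where
  two_le := h.two_le
  bip u v huv := by simp [h.bip u v huv]
  adj i := h.adj (i + 1)
  inj i j := by rw [h.inj]; ring_nf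
  par i := by
    have := h.par (i + 1)
    rw [Int.even_add_one] at this
    by_cases hi : Even i <;> simp_all
  max := h.max

theorem range_flip (f : ℤ → V) : Set.range (fun i => f (i + 1)) = Set.range f :=
  (Equiv.addRight (1 : ℤ)).surjective.range_comp f

theorem eq_of_lt (h : LongCycle G c col f) {i j : ℤ} (hij : f i = f j) (h1 : i - j < 2 * c)
    (h2 : j - i < 2 * c) : i = j := by
  have h3 := (h.inj i j).1 hij
  have h4 : |i - j| < 2 * c := abs_lt.2 ⟨by linarith, h1⟩
  have := Int.eq_zero_of_abs_lt_dvd h3 h4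
  linarith

theorem add_period (h : LongCycle G c col f) (i : ℤ) : f (i + 2 * c) = f i :=
  (h.inj _ _).2 (by simp)

theorem chain_arc (h : LongCycle G c col f) (i : ℤ) (n : ℕ) : (arc f i n).IsChain G.Adj := by
  rw [List.isChain_iff_getElem]
  intro t ht
  have := h.adj (i + t)
  simpa [arc, add_assoc] using this

theorem nodup_arc (h : LongCycle G c col f) (i : ℤ) {n : ℕ} (hn : n ≤ 2 * c) :
    (arc f i n).Nodup := by
  refine List.Nodup.map_on ?_ List.nodup_range
  intro a ha b hb hab
  have := h.eq_of_lt hab (by simp at ha hb; omega) (by simp at ha hb; omega)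
  omega

theorem ear_len (h : LongCycle G c col f) {i : ℤ} {d : ℕ} (hd : 1 ≤ d) (hd2 : d ≤ 2 * c)
    {Q : List V} (hQ : Ear G f (f i) (f (i + d)) Q) : Q.length + 1 ≤ d := by
  obtain ⟨r, hr⟩ : ∃ r, r + d = 2 * c := ⟨2 * c - d, by omega⟩
  have hne := hQ.ne
  have key := h.max (Q ++ arc f (i + d) (r + 1)) ?_ ?_ ?_
  · simp at key; omega
  · refine List.nodup_append'.2 ⟨hQ.nodup, h.nodup_arc _ (by omega), ?_⟩
    exact fun a ha hb => hQ.out a ha (mem_range_of_mem_arc hb)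
  · rw [List.isChain_append]
    refine ⟨hQ.chain, h.chain_arc _ _, ?_⟩
    intro x hx y hy
    simp at hy
    subst hy
    exact hQ.last x hx
  · intro a ha b hb
    rw [List.head?_append] at ha
    rw [List.getLast?_append] at hb
    simp at hb
    have e : f (i + d + r) = f i := by
      rw [← h.add_period i]; congr 1
      have : (r : ℤ) + d = 2 * c := by exact_mod_cast hr
      linarith
    rw [← hb, e]
    apply hQ.head
    cases Q <;> simp_all

theorem cross_len (h : LongCycle G c col f) {i : ℤ} {d₁ d₂ d₃ : ℕ} (hd1 : 1 ≤ d₁) (hd3 : 1 ≤ d₃)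
    (hd : d₁ + d₂ + d₃ ≤ 2 * c) {Q Q' : List V}
    (hQ : Ear G f (f i) (f (i + d₁ + d₂)) Q)
    (hQ' : Ear G f (f (i + d₁)) (f (i + d₁ + d₂ + d₃)) Q') (hdis : List.Disjoint Q Q') :
    Q.length + Q'.length + 2 ≤ d₁ + d₃ := by
  obtain ⟨r, hr⟩ : ∃ r, r + (d₁ + d₂ + d₃) = 2 * c := ⟨2 * c - (d₁ + d₂ + d₃), by omega⟩
  have hr' : (r : ℤ) + (d₁ + d₂ + d₃) = 2 * c := by exact_mod_cast hr
  have e : f (i + d₁ + d₂ + d₃ + r) = f i := by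
    rw [← h.add_period i]; congr 1; linarith
  have hne := hQ.ne
  have hne' := hQ'.ne
  obtain ⟨a, Q₀, rfl⟩ := List.exists_cons_of_ne_nil hne
  obtain ⟨b, Q₁, rfl⟩ := List.exists_cons_of_ne_nil hne'
  have key := h.max (arc f (i + d₁ + d₂ + d₃) (r + 1) ++ ((a :: Q₀) ++
    ((arc f (i + d₁) (d₂ + 1)).reverse ++ (b :: Q₁)))) ?_ ?_ ?_
  · simp at key; simp; omega
  · have o1 : ∀ x ∈ a :: Q₀, ∀ j n, x ∉ arc f j n :=
      fun x hx j n hj => hQ.out x hx (mem_range_of_mem_arc hj)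
    have o2 : ∀ x ∈ b :: Q₁, ∀ j n, x ∉ arc f j n :=
      fun x hx j n hj => hQ'.out x hx (mem_range_of_mem_arc hj)
    have o3 : ∀ x ∈ arc f (i + d₁ + d₂ + d₃) (r + 1), x ∉ arc f (i + d₁) (d₂ + 1) := by
      intro x hx hy
      obtain ⟨s, hs, rfl⟩ := mem_arc.1 hx
      obtain ⟨t, ht, ht'⟩ := mem_arc.1 hy
      have := h.eq_of_lt ht' (by omega) (by omega)
      omega
    simp only [List.nodup_append', List.nodup_reverse]
    refine ⟨h.nodup_arc _ (by omega), ⟨hQ.nodup, ⟨h.nodup_arc _ (by omega), hQ'.nodup, ?_⟩, ?_⟩, ?_⟩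
    · intro x hx hx'
      exact o2 x hx' _ _ (List.mem_reverse.1 hx)
    · intro x hx hx'
      rcases List.mem_append.1 hx' with hx' | hx'
      · exact o1 x hx _ _ (List.mem_reverse.1 hx')
      · exact hdis hx hx'
    · intro x hx hx'
      rcases List.mem_append.1 hx' with hx' | hx'
      · exact o1 x hx' _ _ hx
      rcases List.mem_append.1 hx' with hx' | hx'
      · exact o3 x hx (List.mem_reverse.1 hx')
      · exact o2 x hx' _ _ hx
  · rw [List.isChain_append, List.isChain_append, List.isChain_append, List.isChain_reverse]
    refine ⟨h.chain_arc _ _, ⟨hQ.chain, ⟨(h.chain_arc _ _).imp fun _ _ hab => hab.symm,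
      hQ'.chain, ?_⟩, ?_⟩, ?_⟩
    · intro x hx y hy
      have := hQ'.head y hy
      simp at hx
      subst hx
      exact this
    · intro x hx y hy
      have := hQ.last x hx
      simp at hy
      subst hy
      exact this
    · intro x hx y hy
      rw [getLast?_arc, e] at hx
      simp at hx
      subst hx
      exact hQ.head y (by simpa using hy)
  · intro x hx y hy
    simp [List.head?_append] at hx
    subst hx
    refine hQ'.last y ?_
    rw [← List.append_assoc, ← List.append_assoc, List.getLast?_append_of_ne_nil _ (by simp)] at hy
    exact hy

end LongCycle

variable {V : Type*} {G : SimpleGraph V} {c : ℕ} {col : V → Bool} {f : ℤ → V}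

theorem Ear.suffix {x y z u : V} {Q₁ Q₂ : List V} (h : Ear G f x y (Q₁ ++ u :: Q₂))
    (hz : G.Adj u z) : Ear G f z y (u :: Q₂) where
  ne := by simp
  nodup := (List.nodup_append'.1 h.nodup).2.1
  chain := (List.isChain_append.1 h.chain).2.1
  out a ha := h.out a (List.mem_append_right _ ha)
  head := by simpa using hz.symm
  last a ha := h.last a (by simpa [List.getLast?_append] using ha)

namespace LongCycle

theorem congr_of_dvd (h : LongCycle G c col f) {x y : ℤ} (hd : (2 * c : ℤ) ∣ x - y) :
    f x = f y := (h.inj _ _).2 hd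

theorem ear_len_lt (h : LongCycle G c col f) {x y : ℤ} {Q : List V}
    (hQ : Ear G f (f x) (f y) Q) {d : ℤ} (hd : 0 < d) (hxy : (2 * c : ℤ) ∣ y - x - d) :
    (Q.length : ℤ) + 1 ≤ d := by
  have hc := h.two_le
  have main : ∀ d : ℤ, 0 < d → d ≤ 2 * c → (2 * c : ℤ) ∣ y - x - d → (Q.length : ℤ) + 1 ≤ d := by
    intro d hd hd2 hxy
    lift d to ℕ using hd.le
    have e : f y = f (x + d) := h.congr_of_dvd (by rwa [← sub_sub])
    rw [e] at hQ
    exact_mod_cast h.ear_len (by omega) (by omega) hQ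
  by_cases hd2 : d ≤ 2 * c
  · exact main d hd hd2 hxy
  have hpos : (0 : ℤ) < 2 * c := by omega
  rcases (Int.emod_nonneg d hpos.ne').lt_or_eq with h0 | h0
  · have := main (d % (2 * c)) h0 (Int.emod_lt_of_pos _ hpos).le (by
      have := Int.emod_add_mul_ediv d (2 * c)
      rw [show y - x - d % (2 * c) = (y - x - d) + (2 * c) * (d / (2 * c)) by linarith]
      exact dvd_add hxy (dvd_mul_right _ _))
    have := Int.emod_lt_of_pos d hpos
    linarith
  · have := main (2 * c) hpos le_rfl (by
      have h3 : (2 * c : ℤ) ∣ d := Int.dvd_of_emod_eq_zero h0.symm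
      have : (2 * c : ℤ) ∣ (y - x - d) + (d - 2 * c) := dvd_add hxy (dvd_sub h3 (dvd_refl _))
      convert this using 1; ring)
    linarith

theorem ear_dist (h : LongCycle G c col f) {x y : ℤ} {Q : List V}
    (hQ : Ear G f (f x) (f y) Q) {d : ℤ} (hd : d ≠ 0) (hxy : (2 * c : ℤ) ∣ y - x - d) :
    (Q.length : ℤ) + 1 ≤ |d| := by
  rcases lt_or_gt_of_ne hd with h0 | h0
  · rw [abs_of_neg h0]
    have := h.ear_len_lt hQ.reverse (d := -d) (by linarith) (by
      rw [show x - y - -d = -(y - x - d) by ring]; exact hxy.neg_right)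
    simpa using this
  · rw [abs_of_pos h0]
    exact h.ear_len_lt hQ h0 hxy

theorem not_adj_pair (h : LongCycle G c col f) {x y : ℤ} {Q : List V}
    (hQ : Ear G f (f x) (f y) Q) (hxy : f x ≠ f y) {u : V} (hu : u ∉ Set.range f) {i j : ℕ}
    (hi : 1 ≤ i) (hj : 1 ≤ j) (hij : i + j ≤ Q.length + 1) (h1 : G.Adj u (f (x - i)))
    (h2 : G.Adj u (f (y - j))) : False := by
  have hc := h.two_le
  have hpos : (0 : ℤ) < 2 * c := by omega
  obtain ⟨D, hD⟩ : ∃ D : ℕ, (D : ℤ) = (y - x) % (2 * c) :=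
    ⟨((y - x) % (2 * c)).toNat, Int.toNat_of_nonneg (Int.emod_nonneg _ hpos.ne')⟩
  have hDlt : (D : ℤ) < 2 * c := hD ▸ Int.emod_lt_of_pos _ hpos
  have hdvd : (2 * c : ℤ) ∣ y - x - D := by
    rw [hD]; exact Int.dvd_self_sub_emod
  have hD0 : D ≠ 0 := by
    rintro rfl
    exact hxy (h.congr_of_dvd (by simpa using hdvd)).symm
  have e1 : f y = f (x + D) := h.congr_of_dvd (by rwa [← sub_sub])
  have e2 : f (y - j) = f (x + D - j) := h.congr_of_dvd (by
    rw [show y - j - (x + D - j) = y - x - D by ring]; exact hdvd)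
  have l1 := h.ear_len_lt hQ (d := D) (by omega) hdvd
  have l2 := h.ear_len_lt hQ.reverse (d := 2 * c - D) (by omega) (by
    rw [show x - y - (2 * c - D) = -((y - x - D) + 2 * c) by ring]
    exact (dvd_add hdvd (dvd_refl _)).neg_right)
  rw [List.length_reverse] at l2
  by_cases hm : u ∈ Q
  · obtain ⟨Q₁, Q₂, rfl⟩ := List.append_of_mem hm
    have r1 := h.ear_len_lt (hQ.suffix h2) (d := j) (by omega) (by simp)
    have hQ' := hQ.reverse
    rw [List.reverse_append, List.reverse_cons, List.append_assoc] at hQ'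
    have r2 := h.ear_len_lt (Ear.suffix hQ' h1) (d := i) (by omega) (by simp)
    simp at r1 r2 hij
    omega
  · obtain ⟨t, rfl⟩ : ∃ t, D = t + j := ⟨D - j, by omega⟩
    have h1' := h1
    have q1 : Ear G f (f (x - i)) (f (x - i + i + t)) [u] := by
      refine Ear.singleton hu h1 ?_
      rw [e2] at h2
      convert h2 using 2
      push_cast; ring
    have q2 : Ear G f (f (x - i + i)) (f (x - i + i + t + j)) Q := by
      rw [e1] at hQ
      rw [sub_add_cancel, add_assoc, ← Nat.cast_add]
      exact hQ
    have := h.cross_len hi hj (by push_cast at *; omega) q1 q2 (by simpa using hm)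
    simp at this
    omega

end LongCycle

section ZModCombinatorics

variable [NeZero c]

theorem eq_univ_of_sub_one_mem {T : Finset (ZMod c)} (hT : T.Nonempty)
    (h : ∀ z ∈ T, z - 1 ∈ T) : T = univ := by
  obtain ⟨z, hz⟩ := hT
  have key : ∀ n : ℕ, z - n ∈ T := by
    intro n
    induction n with
    | zero => simpa
    | succ n ih =>
      have := h _ ih
      rwa [sub_sub, ← Nat.cast_succ] at this
  ext w
  simp only [mem_univ, iff_true]
  have := key (z - w).val
  rwa [ZMod.natCast_zmod_val, sub_sub_cancel] at this

/-- Elements obtained from `Y` by going back at most `t` steps. -/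
def back (Y : Finset (ZMod c)) (t : ℕ) : Finset (ZMod c) :=
  univ.filter fun z => ∃ y ∈ Y, ∃ s : ℕ, s ≤ t ∧ z = y - s

theorem mem_back {Y : Finset (ZMod c)} {t : ℕ} {z : ZMod c} :
    z ∈ back Y t ↔ ∃ y ∈ Y, ∃ s : ℕ, s ≤ t ∧ z = y - s := by simp [back]

theorem le_card_back {Y : Finset (ZMod c)} (hY : Y.Nonempty) (t : ℕ) :
    min c (Y.card + t) ≤ (back Y t).card := by
  have hsub : Y ⊆ back Y t := fun y hy => mem_back.2 ⟨y, hy, 0, by omega, by simp⟩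
  induction t with
  | zero => exact (min_le_right _ _).trans (card_le_card hsub)
  | succ t ih =>
    have ih := ih fun y hy => mem_back.2 ⟨y, hy, 0, by omega, by simp⟩
    have hmono : back Y t ⊆ back Y (t + 1) := fun z hz => by
      obtain ⟨y, hy, s, hs, rfl⟩ := mem_back.1 hz
      exact mem_back.2 ⟨y, hy, s, by omega, rfl⟩
    by_cases hu : back Y t = univ
    · have : (back Y t).card = c := by rw [hu, card_univ, ZMod.card]
      have := card_le_card hmono
      omega
    · have : ∃ z ∈ back Y t, z - 1 ∉ back Y t := by
        by_contra! hcon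
        refine hu (eq_univ_of_sub_one_mem ?_ hcon)
        obtain ⟨y, hy⟩ := hY
        exact ⟨y, mem_back.2 ⟨y, hy, 0, by omega, by simp⟩⟩
      obtain ⟨z, hz, hz'⟩ := this
      obtain ⟨y, hy, s, hs, rfl⟩ := mem_back.1 hz
      have hmem : y - s - 1 ∈ back Y (t + 1) :=
        mem_back.2 ⟨y, hy, s + 1, by omega, by push_cast; ring⟩
      have : back Y t ⊂ back Y (t + 1) :=
        (ssubset_iff_of_subset hmono).2 ⟨_, hmem, hz'⟩
      have := card_lt_card this
      omega

theorem card_add_card_add_le {A B : Finset (ZMod c)} (hA : A.Nonempty) (hB : B.Nonempty)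
    (e : ZMod c) (t : ℕ) (h : ∀ a ∈ A, ∀ b ∈ B, ∀ s : ℕ, s ≤ t → a ≠ b + e - s) :
    A.card + B.card + t ≤ c := by
  set B' := B.image (· + e) with hB'
  have cB : B'.card = B.card := card_image_of_injective _ (add_left_injective e)
  have hk := le_card_back (hB.image (· + e)) t
  rw [← hB', cB] at hk
  have hdis : Disjoint A (back B' t) := by
    rw [disjoint_left]
    intro a ha hb
    obtain ⟨y, hy, s, hs, rfl⟩ := mem_back.1 hb
    obtain ⟨b', hb', rfl⟩ := mem_image.1 hy
    exact h _ ha b' hb' s hs rfl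
  have h1 : A.card + (back B' t).card ≤ c := by
    rw [← card_union_of_disjoint hdis]
    exact (card_le_univ _).trans (ZMod.card c).le
  have := hA.card_pos
  omega

omit [NeZero c] in
theorem card_range_image (x : ZMod c) {n : ℕ} (hn : n ≤ c) :
    ((range n).image fun s : ℕ => x - (s : ZMod c)).card = n := by
  rw [card_image_of_injOn, card_range]
  intro a ha b hb hab
  have : (a : ZMod c) = b := by simpa using hab
  have := (ZMod.natCast_eq_natCast_iff' a b c).1 this
  simp at ha hb
  rwa [Nat.mod_eq_of_lt (by omega), Nat.mod_eq_of_lt (by omega)] at this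

theorem card_miss_trichotomy {Y Miss : Finset (ZMod c)} (hY : Y.Nonempty) (x : ZMod c) (r : ℕ)
    (h : ∀ y ∈ Y, ∀ s t : ℕ, s + t ≤ r → x - s ∈ Miss ∨ y - t ∈ Miss)
    (hne : ∀ y ∈ Y, ∀ s t : ℕ, s ≤ r → t ≤ r → x - s ≠ y - t) :
    Y.card + r ≤ Miss.card ∨ Miss = univ ∨ ∀ s : ℕ, s ≤ r → x - s ∈ Miss := by
  classical
  by_cases h3 : ∀ s : ℕ, s ≤ r → x - s ∈ Miss
  · exact Or.inr (Or.inr h3)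
  push Not at h3
  have hs0r : Nat.find h3 ≤ r := (Nat.find_spec h3).1
  have hs0 := (Nat.find_spec h3).2
  have hmin : ∀ s < Nat.find h3, x - s ∈ Miss := by
    intro s hs
    by_contra hcon
    exact Nat.find_min h3 hs ⟨by omega, hcon⟩
  set s₀ := Nat.find h3
  have hc : s₀ ≤ c := by
    by_contra! hcon
    have h0 : (c : ℕ) ≤ s₀ := hcon.le
    apply hs0
    have := hmin (s₀ % c) (lt_of_lt_of_le (Nat.mod_lt _ (NeZero.pos c)) h0)
    rwa [ZMod.natCast_mod] at this
  have hT : back Y (r - s₀) ⊆ Miss := by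
    intro z hz
    obtain ⟨y, hy, t, ht, rfl⟩ := mem_back.1 hz
    exact (h y hy s₀ t (by omega)).resolve_left hs0
  have hk := le_card_back hY (r - s₀)
  have hdis : Disjoint ((range s₀).image fun s : ℕ => x - (s : ZMod c)) (back Y (r - s₀)) := by
    rw [disjoint_left]
    intro z hz hz'
    obtain ⟨s, hs, rfl⟩ := mem_image.1 hz
    obtain ⟨y, hy, t, ht, e⟩ := mem_back.1 hz'
    simp at hs
    exact hne y hy s t (by omega) (by omega) e
  have hsub : ((range s₀).image fun s : ℕ => x - (s : ZMod c)) ∪ back Y (r - s₀) ⊆ Miss := by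
    refine union_subset ?_ hT
    intro z hz
    obtain ⟨s, hs, rfl⟩ := mem_image.1 hz
    exact hmin s (by simpa using hs)
  have hcard := card_le_card hsub
  rw [card_union_of_disjoint hdis, card_range_image x hc] at hcard
  by_cases hcu : c ≤ Y.card + (r - s₀)
  · right; left
    rw [← card_eq_iff_eq_univ, ZMod.card]
    have := (card_le_univ Miss).trans (ZMod.card c).le
    omega
  · left; omega

theorem card_add_card_of_separated_aux {A B : Finset (ZMod c)} {l : ℕ} (hl : 1 ≤ l)
    (hlc : l < c) (hB : B.Nonempty)
    (h : ∀ a ∈ A, ∀ b ∈ B, a ≠ b → ∀ s : ℕ, s ≤ l → a ≠ b + s ∧ b ≠ a + s)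
    {x : ZMod c} (hxA : x ∈ A) (hxB : x ∉ B) : A.card + B.card + 2 * l ≤ c + 1 := by
  classical
  have hex : ∃ s : ℕ, x + s ∈ B := by
    obtain ⟨b, hb⟩ := hB
    exact ⟨(b - x).val, by rwa [ZMod.natCast_zmod_val, add_sub_cancel]⟩
  have hs := Nat.find_spec hex
  have hmin := fun {m : ℕ} => Nat.find_min (m := m) hex
  set s := Nat.find hex
  have hcast : ∀ i : ℕ, 1 ≤ i → i ≤ l → (i : ZMod c) ≠ 0 := by
    intro i hi hi' h0
    rw [ZMod.natCast_eq_zero_iff] at h0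
    have := Nat.le_of_dvd hi h0
    omega
  have hsl : l + 1 ≤ s := by
    by_contra! hcon
    exact (h x hxA _ hs (fun e => hxB (e ▸ hs)) s (by omega)).2 rfl
  set D₁ := back (B.image (· + (l : ZMod c))) (l - 1) with hD1
  set D₂ := (range l).image fun i : ℕ => (x + s - 1) - (i : ZMod c) with hD2
  have c1 := le_card_back (hB.image (· + (l : ZMod c))) (l - 1)
  rw [card_image_of_injective _ (add_left_injective _), ← hD1] at c1
  have c2 : D₂.card = l := card_range_image _ hlc.le
  have m1 : ∀ z ∈ D₁, ∃ b ∈ B, ∃ i : ℕ, 1 ≤ i ∧ i ≤ l ∧ z = b + i := by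
    intro z hz
    obtain ⟨y, hy, t, ht, rfl⟩ := mem_back.1 hz
    obtain ⟨b, hb, rfl⟩ := mem_image.1 hy
    refine ⟨b, hb, l - t, by omega, by omega, ?_⟩
    rw [Nat.cast_sub (by omega)]; ring
  have m2 : ∀ z ∈ D₂, ∃ j : ℕ, 1 ≤ j ∧ j ≤ l ∧ z = x + s - j := by
    intro z hz
    obtain ⟨i, hi, rfl⟩ := mem_image.1 hz
    simp at hi
    exact ⟨i + 1, by omega, by omega, by push_cast; ring⟩
  have d1 : Disjoint A D₁ := by
    rw [disjoint_left]
    intro z hz hz'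
    obtain ⟨b, hb, i, hi, hi', rfl⟩ := m1 z hz'
    refine (h _ hz b hb ?_ i hi').1 rfl
    intro e
    exact hcast i hi hi' (by simpa using e)
  have d2 : Disjoint A D₂ := by
    rw [disjoint_left]
    intro z hz hz'
    obtain ⟨j, hj, hj', rfl⟩ := m2 z hz'
    refine (h _ hz _ hs ?_ j hj').2 (by ring)
    intro e
    exact hcast j hj hj' (by simpa using e)
  have d3 : Disjoint D₁ D₂ := by
    rw [disjoint_left]
    intro z hz hz'
    obtain ⟨b, hb, i, hi, hi', rfl⟩ := m1 z hz
    obtain ⟨j, hj, hj', e⟩ := m2 _ hz'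
    by_cases hle : i + j ≤ s
    · refine hmin (m := s - (i + j)) (by omega) ?_
      rw [Nat.cast_sub hle]
      convert hb using 1
      push_cast
      linear_combination -e
    · refine (h x hxA b hb (fun e => hxB (e ▸ hb)) (i + j - s) (by omega)).1 ?_
      rw [Nat.cast_sub (by omega)]
      push_cast
      linear_combination -e
  have htot : (A ∪ D₁ ∪ D₂).card ≤ c := (card_le_univ _).trans (ZMod.card c).le
  rw [card_union_of_disjoint (disjoint_union_left.2 ⟨d2, d3⟩), card_union_of_disjoint d1] at htot
  have := card_pos.2 ⟨x, hxA⟩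
  omega

theorem card_add_card_of_separated {A B : Finset (ZMod c)} {l : ℕ} (hl : 1 ≤ l)
    (h : ∀ a ∈ A, ∀ b ∈ B, a ≠ b → ∀ s : ℕ, s ≤ l → a ≠ b + s ∧ b ≠ a + s)
    {a b : ZMod c} (ha : a ∈ A) (hb : b ∈ B) (hab : a ≠ b) :
    (A = B ∧ 2 ≤ A.card ∧ A.card * (l + 1) ≤ c ∧
      (A.card * (l + 1) = c → ∀ z, ∃ a ∈ A, ∃ s : ℕ, s ≤ l ∧ z = a + s)) ∨
      A.card + B.card + 2 * l ≤ c + 1 := by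
  classical
  have hlc : l < c := by
    by_contra! hcon
    refine (h a ha b hb hab (a - b).val ((ZMod.val_lt _).le.trans hcon)).1 ?_
    rw [ZMod.natCast_zmod_val]; ring
  by_cases h1 : ∃ x ∈ A, x ∉ B
  · obtain ⟨x, hxA, hxB⟩ := h1
    exact Or.inr (card_add_card_of_separated_aux hl hlc ⟨b, hb⟩ h hxA hxB)
  by_cases h2 : ∃ x ∈ B, x ∉ A
  · obtain ⟨x, hxA, hxB⟩ := h2
    have := card_add_card_of_separated_aux hl hlc ⟨a, ha⟩
      (fun a ha b hb hab s hs => (h b hb a ha hab.symm s hs).symm) hxA hxB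
    right; omega
  push Not at h1 h2
  obtain rfl : A = B := Subset.antisymm h1 h2
  left
  set φ : ZMod c × ℕ → ZMod c := fun p => p.1 + p.2
  have hinj : Set.InjOn φ (A ×ˢ range (l + 1) : Finset (ZMod c × ℕ)) := by
    have key : ∀ a ∈ A, ∀ b ∈ A, ∀ i j : ℕ, i ≤ j → j ≤ l → a + i = b + j → a = b ∧ i = j := by
      intro a ha b hb i j hij hj e
      have e1 : a = b + ((j - i : ℕ) : ZMod c) := by
        rw [Nat.cast_sub hij]; linear_combination e
      have e2 : a = b := by
        by_contra hne
        exact (h a ha b hb hne (j - i) (by omega)).1 e1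
      subst e2
      refine ⟨rfl, ?_⟩
      have : ((j - i : ℕ) : ZMod c) = 0 := by simpa using e1
      rw [ZMod.natCast_eq_zero_iff] at this
      have := Nat.eq_zero_of_dvd_of_lt this (by omega)
      omega
    rintro ⟨a, i⟩ hai ⟨b, j⟩ hbj e
    simp at hai hbj
    rcases le_total i j with hij | hij
    · obtain ⟨rfl, rfl⟩ := key a hai.1 b hbj.1 i j hij (by omega) e
      rfl
    · obtain ⟨rfl, rfl⟩ := key b hbj.1 a hai.1 j i hij (by omega) e.symm
      rfl
  have hcard : ((A ×ˢ range (l + 1)).image φ).card = A.card * (l + 1) := by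
    rw [card_image_of_injOn hinj, card_product, card_range]
  refine ⟨rfl, one_lt_card.2 ⟨a, ha, b, hb, hab⟩, ?_, ?_⟩
  · rw [← hcard]
    exact (card_le_univ _).trans (ZMod.card c).le
  · intro hc z
    have : (A ×ˢ range (l + 1)).image φ = univ := by
      rw [← card_eq_iff_eq_univ, ZMod.card, hcard, hc]
    have hz := mem_univ z
    rw [← this] at hz
    obtain ⟨⟨a, i⟩, hai, rfl⟩ := mem_image.1 hz
    simp at hai
    exact ⟨a, hai.1, i, by omega, rfl⟩

end ZModCombinatorics

variable {V : Type*} {G : SimpleGraph V} {c : ℕ} {col : V → Bool} {f : ℤ → V}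

theorem color_last (hbip : ∀ u v, G.Adj u v → col v = !col u) {l : List V} {a b : V}
    (hl : l.IsChain G.Adj) (ha : a ∈ l.head?) (hb : b ∈ l.getLast?) :
    col b = col a ↔ l.length % 2 = 1 := by
  induction l generalizing a with
  | nil => simp at ha
  | cons x l ih =>
    simp at ha
    subst ha
    cases l with
    | nil => simp at hb; simp [hb]
    | cons y l =>
      have h1 := (List.isChain_cons_cons.1 hl)
      have h2 := ih h1.2 (a := y) (by simp) (by simpa using hb)
      rw [hbip _ _ h1.1] at h2
      simp only [List.length_cons] at h2 ⊢
      have : col b = col x ↔ ¬ col b = !col x := by cases col b <;> cases col x <;> simp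
      rw [this, h2]
      omega

theorem countP_color (hbip : ∀ u v, G.Adj u v → col v = !col u) {l : List V} {a : V}
    (hl : l.IsChain G.Adj) (ha : a ∈ l.head?) :
    l.countP (fun v => col v = col a) = (l.length + 1) / 2 ∧
      l.countP (fun v => col v = !col a) = l.length / 2 := by
  induction l generalizing a with
  | nil => simp at ha
  | cons x l ih =>
    simp at ha
    subst ha
    cases l with
    | nil => simp
    | cons y l =>
      have h1 := (List.isChain_cons_cons.1 hl)
      have h2 := ih h1.2 (a := y) (by simp)
      rw [hbip _ _ h1.1] at h2
      simp only [Bool.not_not] at h2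
      have e1 := List.countP_cons (p := fun v => decide (col v = col x)) (a := x) (l := y :: l)
      have e2 := List.countP_cons (p := fun v => decide (col v = !col x)) (a := x) (l := y :: l)
      rw [h2.2] at e1
      rw [h2.1] at e2
      rw [e1, e2]
      simp
      omega

section

open scoped Classical

/-- Neighbours of `v` in `H`. -/
noncomputable def nb (G : SimpleGraph V) (H : Finset V) (v : V) : Finset V :=
  H.filter fun w => G.Adj v w

@[simp] theorem mem_nb {H : Finset V} {v w : V} : w ∈ nb G H v ↔ w ∈ H ∧ G.Adj v w := by
  simp [nb]

theorem card_nb_head_le (hbip : ∀ u v, G.Adj u v → col v = !col u) {l : List V} {a : V}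
    (hl : l.IsChain G.Adj) (ha : a ∈ l.head?) {H : Finset V} (hH : ∀ w ∈ nb G H a, w ∈ l) :
    (nb G H a).card ≤ l.length / 2 := by
  rw [← (countP_color hbip hl ha).2, List.countP_eq_length_filter]
  refine (card_le_card (t := (l.filter fun v => col v = !col a).toFinset) ?_).trans
    (List.toFinset_card_le _)
  intro w hw
  simp only [List.mem_toFinset, List.mem_filter, decide_eq_true_eq]
  exact ⟨hH w hw, hbip _ _ (mem_nb.1 hw).2⟩

theorem card_nb_last_le (hbip : ∀ u v, G.Adj u v → col v = !col u) {l : List V} {a : V}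
    (hl : l.IsChain G.Adj) (ha : a ∈ l.getLast?) {H : Finset V} (hH : ∀ w ∈ nb G H a, w ∈ l) :
    (nb G H a).card ≤ l.length / 2 := by
  have := card_nb_head_le hbip (l := l.reverse) (a := a)
    (List.isChain_reverse.2 (hl.imp fun _ _ hab => hab.symm)) (by simpa using ha) (H := H)
    (by simpa using hH)
  simpa using this

variable [Fintype V]

/-- The vertices of the cycle. -/
noncomputable def cyc (f : ℤ → V) : Finset V := univ.filter fun v => v ∈ Set.range f

@[simp] theorem mem_cyc {v : V} : v ∈ cyc f ↔ v ∈ Set.range f := by simp [cyc]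

theorem cyc_flip (f : ℤ → V) : cyc (fun i => f (i + 1)) = cyc f := by
  ext v
  rw [mem_cyc, mem_cyc, LongCycle.range_flip]

variable [NeZero c]

/-- Indices of the neighbours of `v` at odd positions of the cycle. -/
noncomputable def idx (G : SimpleGraph V) (c : ℕ) [NeZero c] (f : ℤ → V) (v : V) :
    Finset (ZMod c) := univ.filter fun j => G.Adj v (f (2 * (j.val : ℤ) + 1))

namespace LongCycle

omit [Fintype V] in
theorem mem_idx (h : LongCycle G c col f) (v : V) (k : ℤ) :
    (k : ZMod c) ∈ idx G c f v ↔ G.Adj v (f (2 * k + 1)) := by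
  have : f (2 * ((k : ZMod c).val : ℤ) + 1) = f (2 * k + 1) := by
    refine h.congr_of_dvd ?_
    rw [ZMod.val_intCast]
    have := (Int.dvd_self_sub_emod (x := k) (m := c)).neg_right
    rw [show 2 * (k % c) + 1 - (2 * k + 1) = 2 * (-(k - k % c)) by ring]
    exact mul_dvd_mul_left 2 this
  rw [idx, mem_filter, this]
  simp

theorem card_idx (h : LongCycle G c col f) {v : V} (hv : col v = true) :
    (nb G (cyc f) v).card = (idx G c f v).card := by
  symm
  refine card_bij (fun j _ => f (2 * (j.val : ℤ) + 1)) ?_ ?_ ?_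
  · intro j hj
    simpa [idx] using hj
  · intro i _ j _ hij
    have h1 := ZMod.val_lt i
    have h2 := ZMod.val_lt j
    have := h.eq_of_lt hij (by omega) (by omega)
    exact ZMod.val_injective c (by omega)
  · intro w hw
    rw [mem_nb, mem_cyc] at hw
    obtain ⟨⟨k, rfl⟩, hk⟩ := hw
    have h1 := h.bip _ _ hk
    have : ¬ Even k := by
      rw [← h.par, h1, hv]; simp
    obtain ⟨j, rfl⟩ := Int.not_even_iff_odd.1 this
    refine ⟨(j : ZMod c), (h.mem_idx v j).2 hk, ?_⟩
    have := (h.mem_idx v j).2 hk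
    refine h.congr_of_dvd ?_
    rw [ZMod.val_intCast]
    have := (Int.dvd_self_sub_emod (x := j) (m := c)).neg_right
    rw [show 2 * (j % c) + 1 - (2 * j + 1) = 2 * (-(j - j % c)) by ring]
    exact mul_dvd_mul_left 2 this

omit [Fintype V] [NeZero c] in
theorem ear_of_path (_h : LongCycle G c col f) {P : List V} {u w : V} (hn : P.Nodup)
    (hP : P.IsChain G.Adj) (ho : ∀ a ∈ P, a ∉ Set.range f) (hu : u ∈ P.head?)
    (hw : w ∈ P.getLast?) {x y : V} (hx : G.Adj u x) (hy : G.Adj w y) : Ear G f x y P where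
  ne := by rintro rfl; simp at hu
  nodup := hn
  chain := hP
  out := ho
  head a ha := by
    obtain rfl : a = u := Option.mem_unique ha hu
    exact hx.symm
  last a ha := by
    obtain rfl : a = w := Option.mem_unique ha hw
    exact hy

omit [Fintype V] [NeZero c] in
theorem dvd_of_cast_eq {a b : ℤ} (hab : (a : ZMod c) = b) : (2 * c : ℤ) ∣ 2 * b - 2 * a := by
  rw [ZMod.intCast_eq_intCast_iff_dvd_sub] at hab
  rw [← mul_sub]
  exact mul_dvd_mul_left 2 hab

/-- Degree of `v` into the cycle. -/
noncomputable def _root_.LiNing.dC (G : SimpleGraph V) (f : ℤ → V) (v : V) : ℕ :=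
  (nb G (cyc f) v).card

theorem dC_flip (v : V) : dC G (fun i => f (i + 1)) v = dC G f v := by rw [dC, dC, cyc_flip]

theorem path_bound_even (h : LongCycle G c col f) {P : List V} {u w : V} (hn : P.Nodup)
    (hP : P.IsChain G.Adj) (ho : ∀ a ∈ P, a ∉ Set.range f) (hu : u ∈ P.head?)
    (hw : w ∈ P.getLast?) (hev : P.length % 2 = 0) (hu0 : 0 < dC G f u) (hw0 : 0 < dC G f w) :
    dC G f u + dC G f w + P.length ≤ c + 1 := by
  wlog hc : col u = true generalizing col f
  · have := this h.flip (by rwa [LongCycle.range_flip]) (by rwa [dC_flip]) (by rwa [dC_flip])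
      (by simp [hc])
    simpa [dC_flip] using this
  have hcw : col w = false := by
    have := color_last h.bip hP hu hw
    rw [hc] at this
    have : ¬ col w = true := by rw [this]; omega
    simpa using this
  have e1 : dC G f u = (idx G c f u).card := h.card_idx hc
  have e2 : dC G f w = (idx G c (fun i => f (i + 1)) w).card := by
    rw [← dC_flip]; exact h.flip.card_idx (by simp [hcw])
  rw [e1] at hu0 ⊢
  rw [e2] at hw0 ⊢
  have hlen : P.length ≠ 0 := by
    rintro h0; rw [List.length_eq_zero_iff] at h0; subst h0; simp at hu
  obtain ⟨l, hl⟩ : ∃ l, P.length = 2 * (l + 1) := ⟨P.length / 2 - 1, by omega⟩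
  have := card_add_card_add_le (card_pos.1 hu0) (card_pos.1 hw0) ((l + 1 : ℕ) : ZMod c)
    (2 * l + 1) ?_
  · omega
  intro a ha b hb s hs hab
  obtain ⟨a, rfl⟩ := ZMod.intCast_surjective a
  obtain ⟨b, rfl⟩ := ZMod.intCast_surjective b
  rw [h.mem_idx] at ha
  rw [h.flip.mem_idx] at hb
  have hd := dvd_of_cast_eq (c := c) (a := a) (b := b + (l + 1 : ℕ) - s) (by
    push_cast; rw [hab]; push_cast; ring)
  have := h.ear_dist (h.ear_of_path hn hP ho hu hw ha hb) (d := 2 * s - 2 * l - 1) (by omega) (by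
    convert hd using 1; push_cast; ring)
  rw [hl] at this
  have : |2 * (s : ℤ) - 2 * l - 1| ≤ 2 * l + 1 := abs_le.2 ⟨by omega, by omega⟩
  push_cast at *
  omega

theorem dC_add_dC_le (h : LongCycle G c col f) {u w : V} (hu : u ∉ Set.range f)
    (hw : w ∉ Set.range f) (huw : col u ≠ col w) : dC G f u + dC G f w ≤ c + 1 := by
  wlog hc : col u = true generalizing col f
  · have := this h.flip (by rwa [LongCycle.range_flip]) (by rwa [LongCycle.range_flip])
      (by simpa using huw) (by simp [hc])
    simpa [dC_flip] using this
  have hcw : col w = false := by cases hx : col w <;> simp_all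
  have e1 : dC G f u = (idx G c f u).card := h.card_idx hc
  have e2 : dC G f w = (idx G c (fun i => f (i + 1)) w).card := by
    rw [← dC_flip]; exact h.flip.card_idx (by simp [hcw])
  rw [e1, e2, ← card_union_add_card_inter]
  refine add_le_add ((card_le_univ _).trans (ZMod.card c).le) (card_le_one.2 ?_)
  intro a ha b hb
  obtain ⟨a, rfl⟩ := ZMod.intCast_surjective a
  obtain ⟨b, rfl⟩ := ZMod.intCast_surjective b
  rw [mem_inter, h.mem_idx, h.flip.mem_idx] at ha hb
  by_contra hab
  refine h.not_adj_pair (Ear.singleton hw ha.2 hb.2) ?_ hu (i := 1) (j := 1) le_rfl le_rfl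
    (by simp) ?_ ?_
  · intro e
    apply hab
    rw [ZMod.intCast_eq_intCast_iff_dvd_sub]
    have := (h.inj _ _).1 e
    rw [show 2 * a + 1 + 1 - (2 * b + 1 + 1) = 2 * (a - b) by ring] at this
    have := Int.dvd_of_mul_dvd_mul_left (by norm_num) this
    exact (dvd_sub_comm).1 this
  · convert ha.1 using 2; push_cast; ring
  · convert hb.1 using 2; push_cast; ring

theorem path_bound_odd (h : LongCycle G c col f) {P : List V} {u z w : V} {l : ℕ}
    (hn : (u :: w :: P).Nodup)
    (hP : (u :: w :: P).IsChain G.Adj) (ho : ∀ a ∈ u :: w :: P, a ∉ Set.range f)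
    (hz : z ∈ (u :: w :: P).getLast?) (hl : (u :: w :: P).length = 2 * l + 1) {x y : V}
    (hx : x ∈ nb G (cyc f) u) (hy : y ∈ nb G (cyc f) z) (hxy : x ≠ y) :
    (dC G f u = dC G f z ∧ 2 ≤ dC G f u ∧ dC G f u * (l + 1) ≤ c ∧
      (dC G f u * (l + 1) = c → dC G f w = 0)) ∨
    dC G f u + dC G f z + 2 * l ≤ c + 1 := by
  wlog hc : col u = true generalizing col f
  · have := this h.flip (by rwa [LongCycle.range_flip]) (by rwa [cyc_flip]) (by rwa [cyc_flip])
      (by simp [hc])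
    simpa [dC_flip] using this
  have hcz : col z = true := by
    rw [← hc, color_last h.bip hP (by simp) hz, hl]; omega
  have hcw : col w = false := by
    rw [h.bip u w (List.isChain_cons_cons.1 hP).1, hc]; rfl
  have e1 : dC G f u = (idx G c f u).card := h.card_idx hc
  have e2 : dC G f z = (idx G c f z).card := h.card_idx hcz
  have hl1 : 1 ≤ l := by simp at hl; omega
  have odd_pos : ∀ v, col v = true → ∀ x ∈ nb G (cyc f) v, ∃ k : ℤ, x = f (2 * k + 1) := by
    intro v hv x hx
    rw [mem_nb, mem_cyc] at hx
    obtain ⟨⟨k, rfl⟩, hk⟩ := hx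
    have : ¬ Even k := by
      rw [← h.par, h.bip _ _ hk, hv]; simp
    obtain ⟨j, rfl⟩ := Int.not_even_iff_odd.1 this
    exact ⟨j, rfl⟩
  obtain ⟨a, rfl⟩ := odd_pos u hc x hx
  obtain ⟨b, rfl⟩ := odd_pos z hcz y hy
  have ha := (h.mem_idx u a).2 (mem_nb.1 hx).2
  have hb := (h.mem_idx z b).2 (mem_nb.1 hy).2
  have hab : (a : ZMod c) ≠ b := by
    intro e
    exact hxy (h.congr_of_dvd (by
      rw [show 2 * a + 1 - (2 * b + 1) = 2 * a - 2 * b by ring]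
      exact dvd_of_cast_eq e.symm))
  have sep : ∀ a ∈ idx G c f u, ∀ b ∈ idx G c f z, a ≠ b →
      ∀ s : ℕ, s ≤ l → a ≠ b + s ∧ b ≠ a + s := by
    intro a ha b hb hab s hs
    obtain ⟨a, rfl⟩ := ZMod.intCast_surjective a
    obtain ⟨b, rfl⟩ := ZMod.intCast_surjective b
    rw [h.mem_idx] at ha hb
    have key : ∀ d : ℤ, |d| ≤ l → (b : ZMod c) = a + d → False := by
      intro d hd e
      have hd0 : d ≠ 0 := by
        rintro rfl
        simp at e
        exact hab e.symm
      have hdv := dvd_of_cast_eq (c := c) (a := a + d) (b := b) (by push_cast; rw [e])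
      have := h.ear_dist (h.ear_of_path hn hP ho (u := u) (by simp) hz ha hb) (d := 2 * d)
        (by omega) (by convert hdv using 1; ring)
      rw [hl, abs_mul] at this
      push_cast at this
      simp at this
      omega
    constructor
    · intro e
      exact key (-s) (by simpa using hs) (by push_cast; rw [e]; ring)
    · intro e
      exact key s (by simpa using hs) (by push_cast; rw [e])
  rcases card_add_card_of_separated hl1 sep ha hb hab with ⟨r1, r2, r3, r4⟩ | r
  · left
    rw [e1, e2]
    refine ⟨by rw [← r1], r2, r3, fun hcard => ?_⟩
    by_contra hw0
    obtain ⟨y, hy⟩ := card_pos.1 (Nat.pos_of_ne_zero hw0)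
    rw [mem_nb, mem_cyc] at hy
    obtain ⟨⟨k, rfl⟩, hk⟩ := hy
    have : Even k := by
      rw [← h.par, h.bip _ _ hk, hcw]; simp
    obtain ⟨m, rfl⟩ := this
    obtain ⟨t, ht, s, hs, hts⟩ := r4 hcard (m : ZMod c)
    obtain ⟨t, rfl⟩ := ZMod.intCast_surjective t
    rw [r1, h.mem_idx] at ht
    have hdv := dvd_of_cast_eq (c := c) (a := m) (b := t + s) (by push_cast; rw [hts])
    have hd := h.ear_dist (h.ear_of_path (P := w :: P) (List.nodup_cons.1 hn).2
      (List.isChain_cons_cons.1 hP).2 (fun a ha => ho a (List.mem_cons_of_mem _ ha))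
      (u := w) (by simp) (by simpa using hz) hk ht) (d := 1 - 2 * s) (by omega)
      (by convert hdv using 1; ring)
    have h2 : |1 - 2 * (s : ℤ)| ≤ 2 * l - 1 := abs_le.2 ⟨by omega, by omega⟩
    simp at hl hd
    omega
  · right
    rw [e1, e2]; exact r

theorem dC_add_half_ear_le (h : LongCycle G c col f) {x y : ℤ} {Q : List V}
    (hQ : Ear G f (f x) (f y) Q) (hxy : f x ≠ f y) {u : V} (hu : u ∉ Set.range f) :
    dC G f u + Q.length / 2 ≤ c := by
  wlog hc : col u = true generalizing col f x y
  · have := this h.flip (x := x - 1) (y := y - 1) (by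
      have e : ∀ x : ℤ, x - 1 + 1 = x := by intro x; ring
      simp only [e]
      exact ⟨hQ.ne, hQ.nodup, hQ.chain, by rw [LongCycle.range_flip]; exact hQ.out,
        hQ.head, hQ.last⟩) (by simpa using hxy) (by rwa [LongCycle.range_flip]) (by simp [hc])
    simpa [dC_flip] using this
  have e1 : dC G f u = (idx G c f u).card := h.card_idx hc
  rw [e1]
  have hle : (idx G c f u).card ≤ c := (card_le_univ _).trans (ZMod.card c).le
  have hcompl : (idx G c f u)ᶜ.card = c - (idx G c f u).card := by
    rw [card_compl, ZMod.card]
  by_cases hk : Q.length / 2 = 0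
  · omega
  obtain ⟨r, hr⟩ : ∃ r, Q.length / 2 = r + 1 := ⟨Q.length / 2 - 1, by omega⟩
  obtain ⟨X, ex, hx, hex⟩ : ∃ X : ℤ, ∃ e : ℕ, x = 2 * X + e ∧ e ≤ 1 :=
    ⟨x / 2, (x % 2).toNat, by omega, by omega⟩
  obtain ⟨Y, ey, hy, hey⟩ : ∃ Y : ℤ, ∃ e : ℕ, y = 2 * Y + e ∧ e ≤ 1 :=
    ⟨y / 2, (y % 2).toNat, by omega, by omega⟩
  have hpar : (ex + ey + Q.length + 1) % 2 = 0 := by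
    obtain ⟨a, Q', rfl⟩ := List.exists_cons_of_ne_nil hQ.ne
    obtain ⟨b, hb⟩ : ∃ b, b ∈ (a :: Q').getLast? := ⟨_, List.getLast?_eq_some_getLast (by simp)⟩
    have q1 := color_last h.bip hQ.chain (a := a) (by simp) hb
    have q2 := h.bip _ _ (hQ.head a (by simp))
    have q3 := h.bip _ _ (hQ.last b hb)
    have q4 := h.par x
    have q5 := h.par y
    rw [hx, Int.even_iff] at q4
    rw [hy, Int.even_iff] at q5
    rw [← hx] at q4
    rw [← hy] at q5
    rcases Bool.eq_false_or_eq_true (col (f x)) with c1 | c1 <;>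
    rcases Bool.eq_false_or_eq_true (col b) with c2 | c2 <;>
    simp only [c1, c2, Bool.not_true, Bool.not_false, true_iff, false_iff, q2, q3, reduceCtorEq]
      at q1 q4 q5 <;> omega
  have hd : ∀ d : ℤ, (2 * c : ℤ) ∣ y - x - d → (Q.length : ℤ) + 1 ≤ |d| := by
    intro d hd
    refine h.ear_dist hQ ?_ hd
    rintro rfl
    exact hxy (h.congr_of_dvd (by simpa using hd)).symm
  have tri := card_miss_trichotomy (c := c) (Y := {((Y - 1 : ℤ) : ZMod c)})
    (Miss := (idx G c f u)ᶜ) (singleton_nonempty _) ((X - 1 : ℤ) : ZMod c) r ?_ ?_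
  · rcases tri with t | t | t
    · simp at t; omega
    · have h0 : (idx G c f u) = ∅ := by simpa using congrArg compl t
      rw [h0, card_empty]
      have hc2 : (Q.length : ℤ) + 1 ≤ 2 * c := by
        have hpos : (0 : ℤ) < 2 * c := by have := h.two_le; omega
        have := hd ((y - x) % (2 * c)) Int.dvd_self_sub_emod
        have h1 := Int.emod_lt_of_pos (y - x) hpos
        have h2 := Int.emod_nonneg (y - x) hpos.ne'
        rw [abs_of_nonneg h2] at this
        omega
      omega
    · have hsub : ((range (r + 1)).image fun s : ℕ => ((X - 1 : ℤ) : ZMod c) - (s : ZMod c)) ⊆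
          (idx G c f u)ᶜ := by
        intro z hz
        obtain ⟨s, hs, rfl⟩ := mem_image.1 hz
        simp at hs
        exact t s (by omega)
      have := card_le_card hsub
      rw [card_range_image _ ?_] at this
      · omega
      · have hpos : (0 : ℤ) < 2 * c := by have := h.two_le; omega
        have := hd ((y - x) % (2 * c)) Int.dvd_self_sub_emod
        have h1 := Int.emod_lt_of_pos (y - x) hpos
        have h2 := Int.emod_nonneg (y - x) hpos.ne'
        rw [abs_of_nonneg h2] at this
        omega
  · intro y' hy' s t hst
    simp only [mem_singleton] at hy'
    subst hy'
    by_contra! hcon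
    simp only [mem_compl, not_not] at hcon
    have h1 := (h.mem_idx u (X - 1 - s)).1 (by push_cast at hcon ⊢; exact hcon.1)
    have h2 := (h.mem_idx u (Y - 1 - t)).1 (by push_cast at hcon ⊢; exact hcon.2)
    refine h.not_adj_pair hQ hxy hu (i := ex + 1 + 2 * s) (j := ey + 1 + 2 * t) (by omega)
      (by omega) (by omega) ?_ ?_
    · convert h1 using 2; rw [hx]; push_cast; ring
    · convert h2 using 2; rw [hy]; push_cast; ring
  · intro y' hy' s t hs ht e
    simp only [mem_singleton] at hy'
    subst hy'
    have hdv := dvd_of_cast_eq (c := c) (a := X - 1 - s) (b := Y - 1 - t) (by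
      push_cast at e ⊢; exact e)
    have := hd (2 * t - 2 * s + ey - ex) (by convert hdv using 1; rw [hx, hy]; ring)
    have h2 : |2 * (t : ℤ) - 2 * s + ey - ex| ≤ 2 * r + 1 := abs_le.2 ⟨by omega, by omega⟩
    omega

end LongCycle

end

section

open scoped Classical

variable {V : Type*} {G : SimpleGraph V} {col : V → Bool}

theorem isChain_reverse_adj {l : List V} :
    l.reverse.IsChain G.Adj ↔ l.IsChain G.Adj := by
  rw [List.isChain_reverse]
  constructor <;> exact fun h => h.imp fun _ _ hab => hab.symm

/-- The last occurrence in a list of an element satisfying `q`. -/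
theorem exists_last_split {l : List V} {q : V → Prop} (h : ∃ a ∈ l, q a) :
    ∃ l₁ a l₂, l = l₁ ++ a :: l₂ ∧ q a ∧ ∀ b ∈ l₂, ¬ q b := by
  induction l with
  | nil => simp at h
  | cons x l ih =>
    by_cases hl : ∃ a ∈ l, q a
    · obtain ⟨l₁, a, l₂, rfl, ha, hb⟩ := ih hl
      exact ⟨x :: l₁, a, l₂, rfl, ha, hb⟩
    · push Not at hl
      obtain ⟨a, ha, hq⟩ := h
      rcases List.mem_cons.1 ha with rfl | ha
      · exact ⟨[], a, l, rfl, hq, hl⟩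
      · exact absurd hq (hl a ha)

theorem exists_first_split {l : List V} {q : V → Prop} (h : ∃ a ∈ l, q a) :
    ∃ l₁ a l₂, l = l₁ ++ a :: l₂ ∧ q a ∧ ∀ b ∈ l₁, ¬ q b := by
  obtain ⟨l₁, a, l₂, e, ha, hb⟩ := exists_last_split (l := l.reverse) (q := q) (by simpa using h)
  refine ⟨l₂.reverse, a, l₁.reverse, ?_, ha, by simpa using hb⟩
  rw [← List.reverse_reverse l, e]
  simp

/-- A stage in growing a vine backwards along the path `P`: the set `X` contains everything on
`P` beyond the foot `p`, and every exit from `X` is reached from `p` by a long path in `X`. -/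
structure Vine (G : SimpleGraph V) (W H : Finset V) (δ : ℕ) (P : List V) (X : Finset V)
    (L : List V) (p : V) : Prop where
  tail : ∃ T, P = L ++ p :: T ∧ ∀ t ∈ T, t ∈ X
  sub : X ⊆ W
  disj : ∀ v ∈ L ++ [p], v ∉ X
  ne : X.Nonempty
  leave : ∀ x ∈ X, ∀ y ∈ H, y ∉ X → y ≠ p → G.Adj x y →
    ∃ R : List V, (∀ r ∈ R, r ∈ X) ∧ R.Nodup ∧ (p :: (R ++ [y])).IsChain G.Adj ∧
      2 * δ ≤ R.length + 2 ∧ R ≠ []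

theorem Vine.insert_exit {W H X : Finset V} {δ : ℕ} {P L : List V} {p x y : V}
    (h : Vine G W H δ P X L p) (hx : x ∈ X) (hyW : y ∈ W) (hyH : y ∈ H) (hyX : y ∉ X)
    (hyp : y ≠ p) (hyL : y ∉ L) (hxy : G.Adj x y) : Vine G W H δ P (insert y X) L p where
  tail := by
    obtain ⟨T, hT, hTX⟩ := h.tail
    exact ⟨T, hT, fun t ht => mem_insert_of_mem (hTX t ht)⟩
  sub := insert_subset hyW h.sub
  disj v hv := by
    have := h.disj v hv
    simp only [mem_insert, not_or]
    refine ⟨?_, this⟩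
    rintro rfl
    simp only [List.mem_append, List.mem_singleton] at hv
    tauto
  ne := ⟨y, mem_insert_self _ _⟩
  leave x' hx' y' hy'H hy'X hy'p hxy' := by
    simp only [mem_insert, not_or] at hx' hy'X
    rcases hx' with rfl | hx'
    · obtain ⟨R, h1, h2, h3, h4, h5⟩ := h.leave x hx x' hyH hyX hyp hxy
      refine ⟨R ++ [x'], ?_, ?_, ?_, by simp; omega, by simp⟩
      · intro r hr
        rcases List.mem_append.1 hr with hr | hr
        · exact mem_insert_of_mem (h1 r hr)
        · simp at hr; subst hr; exact mem_insert_self _ _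
      · rw [List.nodup_append']
        refine ⟨h2, by simp, ?_⟩
        intro r hr hr'
        simp at hr'; subst hr'
        exact hyX (h1 r hr)
      · have : p :: (R ++ [x'] ++ [y']) = (p :: R) ++ x' :: [y'] := by simp
        rw [this, List.isChain_split]
        exact ⟨by simpa using h3, by simpa using hxy'⟩
    · obtain ⟨R, h1, h2⟩ := h.leave x' hx' y' hy'H hy'X.2 hy'p hxy'
      exact ⟨R, fun r hr => mem_insert_of_mem (h1 r hr), h2⟩

theorem Vine.move_foot {W H X : Finset V} {δ : ℕ} {a : V} {P L₁ L₂ : List V} {p x y : V}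
    (h : Vine G W H δ (a :: P) X (L₁ ++ y :: L₂) p) (hPW : ∀ v ∈ P, v ∈ W)
    (hn : (a :: P).Nodup) (hc : (a :: P).IsChain G.Adj) (hx : x ∈ X) (hyH : y ∈ H)
    (hxy : G.Adj x y) : Vine G W H δ (a :: P) (X ∪ (L₂ ++ [p]).toFinset) L₁ y := by
  obtain ⟨T, hT, hTX⟩ := h.tail
  have hyX : y ∉ X := h.disj y (by simp)
  have hP : a :: P = L₁ ++ y :: ((L₂ ++ [p]) ++ T) := by rw [hT]; simp
  have hn' := hn
  have hc' := hc
  rw [hP] at hn' hc'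
  have hn2 := List.nodup_append'.1 hn'
  have hn3 := List.nodup_cons.1 hn2.2.1
  have hn4 := List.nodup_append'.1 hn3.2
  have hc2 := (List.isChain_split.1 hc').2
  have hyp : y ≠ p := by rintro rfl; exact hn3.1 (by simp)
  have hsub : ∀ v ∈ L₂ ++ [p], v ∈ W := by
    intro v hv
    apply hPW
    cases L₁ with
    | nil =>
      simp only [List.nil_append, List.cons.injEq] at hP
      rw [hP.2]
      exact List.mem_append_left _ hv
    | cons b L₁ =>
      simp only [List.cons_append, List.cons.injEq] at hP
      rw [hP.2]
      exact List.mem_append_right _ (List.mem_cons_of_mem _ (List.mem_append_left _ hv))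
  have hdX : ∀ v ∈ L₂ ++ [p], v ∉ X := by
    intro v hv
    refine h.disj v ?_
    simp only [List.mem_append, List.mem_cons, List.not_mem_nil] at hv ⊢
    tauto
  refine ⟨⟨(L₂ ++ [p]) ++ T, hP, ?_⟩, ?_, ?_, ?_, ?_⟩
  · intro t ht
    rw [mem_union, List.mem_toFinset]
    rcases List.mem_append.1 ht with ht | ht
    · exact Or.inr ht
    · exact Or.inl (hTX t ht)
  · exact union_subset h.sub fun v hv => hsub v (List.mem_toFinset.1 hv)
  · intro v hv hv'
    rw [mem_union, List.mem_toFinset] at hv'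
    rcases hv' with hv' | hv'
    · refine h.disj v ?_ hv'
      simp only [List.mem_append, List.mem_cons, List.not_mem_nil] at hv ⊢
      tauto
    · rcases List.mem_append.1 hv with hv | hv
      · exact hn2.2.2 hv (List.mem_cons_of_mem _ (List.mem_append_left _ hv'))
      · simp at hv; subst hv
        exact hn3.1 (List.mem_append_left _ hv')
  · exact h.ne.mono subset_union_left
  · intro x' hx' y' hy'H hy'X hy'y hxy'
    rw [mem_union, List.mem_toFinset] at hx' hy'X
    push Not at hy'X
    rcases hx' with hx' | hx'
    · obtain ⟨R, h1, h2, h3, h4, h5⟩ := h.leave x' hx' y' hy'H hy'X.1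
        (by rintro rfl; exact hy'X.2 (by simp)) hxy'
      refine ⟨(L₂ ++ [p]) ++ R, ?_, ?_, ?_, by simp; omega, by simp⟩
      · intro r hr
        rw [mem_union, List.mem_toFinset]
        rcases List.mem_append.1 hr with hr | hr
        · exact Or.inr hr
        · exact Or.inl (h1 r hr)
      · exact List.nodup_append'.2 ⟨hn4.1, h2, fun v hv hv' => hdX v hv (h1 v hv')⟩
      · have e : y :: ((L₂ ++ [p]) ++ R ++ [y']) = (y :: L₂) ++ p :: (R ++ [y']) := by simp
        rw [e, List.isChain_split]
        refine ⟨?_, h3⟩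
        have e : y :: ((L₂ ++ [p]) ++ T) = (y :: L₂) ++ p :: T := by simp
        rw [e, List.isChain_split] at hc2
        exact hc2.1
    · obtain ⟨R, h1, h2, h3, h4, h5⟩ := h.leave x hx y hyH hyX hyp hxy
      obtain ⟨M₁, M₂, hM⟩ := List.append_of_mem hx'
      obtain ⟨N, hN⟩ : ∃ N, x' :: M₂ = N ++ [p] := by
        rcases List.eq_nil_or_concat' (x' :: M₂) with h0 | ⟨N, b, h0⟩
        · simp at h0
        · refine ⟨N, ?_⟩
          rw [h0, ← List.append_assoc] at hM
          have := List.append_inj_right' hM rfl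
          simp at this
          rw [h0, this]
      have hsubN : ∀ r ∈ N ++ [p], r ∈ L₂ ++ [p] := by
        intro r hr
        rw [hM, hN]
        exact List.mem_append_right _ hr
      have e : ((N ++ [p]) ++ R).reverse = R.reverse ++ (N ++ [p]).reverse := by simp
      refine ⟨((N ++ [p]) ++ R).reverse, ?_, ?_, ?_, by simp; omega, by simp⟩
      · intro r hr
        rw [mem_union, List.mem_toFinset]
        rcases List.mem_append.1 (List.mem_reverse.1 hr) with hr | hr
        · exact Or.inr (hsubN r hr)
        · exact Or.inl (h1 r hr)
      · rw [List.nodup_reverse]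
        refine List.nodup_append'.2 ⟨?_, h2, fun v hv hv' => hdX v (hsubN v hv) (h1 v hv')⟩
        have := hn4.1
        rw [hM, hN] at this
        exact (List.nodup_append'.1 this).2.1
      · have e : y :: (((N ++ [p]) ++ R).reverse ++ [y']) =
            ((y' :: N) ++ p :: (R ++ [y])).reverse := by simp
        rw [e, isChain_reverse_adj, List.isChain_split]
        refine ⟨?_, h3⟩
        have e2 : y' :: N ++ [p] = [y'] ++ x' :: M₂ := by rw [hN]; simp
        rw [e2, List.isChain_split]
        refine ⟨by simpa using hxy'.symm, ?_⟩
        rw [hM] at hc2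
        have e3 : y :: ((M₁ ++ x' :: M₂) ++ T) = (y :: M₁) ++ x' :: (M₂ ++ T) := by simp
        rw [e3, List.isChain_split] at hc2
        have := hc2.2
        rw [← List.cons_append] at this
        exact (List.isChain_append.1 this).1

theorem Vine.exists_ear {W H X : Finset V} {δ : ℕ} {a : V} {P L : List V} {p : V}
    (h : Vine G W H δ (a :: P) X L p) (hPW : ∀ v ∈ P, v ∈ W) (haH : a ∈ H) (haW : a ∉ W)
    (hWH : W ⊆ H) (hn : (a :: P).Nodup) (hc : (a :: P).IsChain G.Adj)
    (hlink : ∀ X ⊆ W, X.Nonempty → ∀ v, ∃ x ∈ X, ∃ y ∈ H, y ∉ X ∧ y ≠ v ∧ G.Adj x y) :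
    ∃ y ∈ H, y ∉ W ∧ y ≠ a ∧ ∃ Q : List V, Q ≠ [] ∧ Q.Nodup ∧ (∀ q ∈ Q, q ∈ W) ∧
      (a :: (Q ++ [y])).IsChain G.Adj ∧ 2 * δ ≤ Q.length + 2 := by
  suffices ∀ n X L p, Vine G W H δ (a :: P) X L p → W.card ≤ X.card + n →
      ∃ y ∈ H, y ∉ W ∧ y ≠ a ∧ ∃ Q : List V, Q ≠ [] ∧ Q.Nodup ∧ (∀ q ∈ Q, q ∈ W) ∧
      (a :: (Q ++ [y])).IsChain G.Adj ∧ 2 * δ ≤ Q.length + 2 from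
    this W.card X L p h (by omega)
  clear h
  intro n
  induction n with
  | zero =>
    intro X L p h hcard
    obtain ⟨x, hx, y, hyH, hyX, hyp, hxy⟩ := hlink X h.sub h.ne p
    have hXW : X = W := eq_of_subset_of_card_le h.sub (by omega)
    obtain ⟨T, hT, hTX⟩ := h.tail
    subst hXW
    cases L with
    | nil =>
      simp only [List.nil_append, List.cons.injEq] at hT
      obtain ⟨rfl, rfl⟩ := hT
      obtain ⟨R, h1, h2, h3, h4, h5⟩ := h.leave x hx y hyH hyX hyp hxy
      exact ⟨y, hyH, hyX, hyp, R, h5, h2, h1, h3, h4⟩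
    | cons b L =>
      simp only [List.cons_append, List.cons.injEq] at hT
      exact absurd (hPW p (by rw [hT.2]; simp)) (h.disj p (by simp))
  | succ n ih =>
    intro X L p h hcard
    obtain ⟨x, hx, y, hyH, hyX, hyp, hxy⟩ := hlink X h.sub h.ne p
    by_cases hyL : y ∈ L
    · obtain ⟨L₁, L₂, rfl⟩ := List.append_of_mem hyL
      refine ih _ _ _ (h.move_foot hPW hn hc hx hyH hxy) ?_
      have : X ⊂ X ∪ (L₂ ++ [p]).toFinset := by
        refine (ssubset_iff_of_subset subset_union_left).2 ⟨p, by simp, h.disj p (by simp)⟩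
      have := card_lt_card this
      omega
    by_cases hyW : y ∈ W
    · refine ih _ _ _ (h.insert_exit hx hyW hyH hyX hyp hyL hxy) ?_
      rw [card_insert_of_notMem hyX]
      omega
    obtain ⟨R, h1, h2, h3, h4, h5⟩ := h.leave x hx y hyH hyX hyp hxy
    obtain ⟨T, hT, hTX⟩ := h.tail
    cases L with
    | nil =>
      simp only [List.nil_append, List.cons.injEq] at hT
      obtain ⟨rfl, rfl⟩ := hT
      exact ⟨y, hyH, hyW, hyp, R, h5, h2, fun q hq => h.sub (h1 q hq), h3, h4⟩
    | cons b L =>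
      simp only [List.cons_append, List.cons.injEq] at hT
      obtain ⟨rfl, hT⟩ := hT
      refine ⟨y, hyH, hyW, by rintro rfl; simp at hyL, (L ++ [p]) ++ R, by simp, ?_, ?_, ?_,
        by simp; omega⟩
      · rw [hT] at hn
        have hn2 := (List.nodup_cons.1 hn).2
        have e : L ++ p :: T = (L ++ [p]) ++ T := by simp
        rw [e] at hn2
        refine List.nodup_append'.2 ⟨(List.nodup_append'.1 hn2).1, h2, fun v hv hv' => ?_⟩
        exact h.disj v (by simp at hv ⊢; tauto) (h1 v hv')
      · intro q hq
        rcases List.mem_append.1 hq with hq | hq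
        · apply hPW
          rw [hT]
          simp at hq ⊢; tauto
        · exact h.sub (h1 q hq)
      · have e : a :: (L ++ [p] ++ R ++ [y]) = (a :: L) ++ p :: (R ++ [y]) := by simp
        rw [e, List.isChain_split]
        refine ⟨?_, h3⟩
        rw [hT, ← List.cons_append, List.isChain_split] at hc
        exact hc.1

theorem exists_long_ear (hbip : ∀ u v, G.Adj u v → col v = !col u) {W H : Finset V} {a z : V}
    {P : List V} (hPW : ∀ v ∈ P, v ∈ W) (haH : a ∈ H) (haW : a ∉ W)
    (hWH : W ⊆ H) (hn : (a :: P).Nodup) (hc : (a :: P).IsChain G.Adj)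
    (hlink : ∀ X ⊆ W, X.Nonempty → ∀ v, ∃ x ∈ X, ∃ y ∈ H, y ∉ X ∧ y ≠ v ∧ G.Adj x y)
    (hz : z ∈ P.getLast?) (hzP : ∀ v ∈ nb G H z, v ∈ a :: P) :
    ∃ y ∈ H, y ∉ W ∧ y ≠ a ∧ ∃ Q : List V, Q ≠ [] ∧ Q.Nodup ∧ (∀ q ∈ Q, q ∈ W) ∧
      (a :: (Q ++ [y])).IsChain G.Adj ∧ 2 * (nb G H z).card ≤ Q.length + 2 := by
  obtain ⟨P₀, rfl⟩ : ∃ P₀, P = P₀ ++ [z] := by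
    rcases List.eq_nil_or_concat' P with rfl | ⟨P₀, b, rfl⟩
    · simp at hz
    · simp at hz
      exact ⟨P₀, by simp [hz]⟩
  have hcz := hc
  have hex : ∃ v ∈ a :: P₀, G.Adj z v := by
    rw [← List.cons_append] at hc
    have := (List.isChain_append.1 hc).2.2
    refine ⟨_, List.mem_of_getLast? (List.getLast?_eq_some_getLast (by simp)), ?_⟩
    exact (this _ (List.getLast?_eq_some_getLast (by simp)) z (by simp)).symm
  obtain ⟨L, p, T, hL, hp, hL0⟩ := exists_first_split hex
  have hfull : a :: (P₀ ++ [z]) = L ++ p :: (T ++ [z]) := by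
    rw [← List.cons_append, hL]; simp
  have hn1 := hn
  have hc1 := hc
  rw [hfull] at hn1 hc1
  have hn2 := List.nodup_append'.1 hn1
  have hn3 := List.nodup_cons.1 hn2.2.1
  have hc2 := (List.isChain_split.1 hc1).2
  have hTW : ∀ v ∈ T ++ [z], v ∈ W := by
    intro v hv
    apply hPW
    cases L with
    | nil =>
      simp only [List.nil_append, List.cons.injEq] at hfull
      rwa [hfull.2]
    | cons b L =>
      simp only [List.cons_append, List.cons.injEq] at hfull
      rw [hfull.2]
      exact List.mem_append_right _ (List.mem_cons_of_mem _ hv)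
  refine Vine.exists_ear (δ := (nb G H z).card) (X := (T ++ [z]).toFinset) (L := L) (p := p)
    ⟨⟨T ++ [z], hfull, fun t ht => List.mem_toFinset.2 ht⟩, ?_, ?_, ⟨z, by simp⟩, ?_⟩ hPW haH haW hWH hn hc
      hlink
  · exact fun v hv => hTW v (List.mem_toFinset.1 hv)
  · intro v hv hv'
    rw [List.mem_toFinset] at hv'
    rcases List.mem_append.1 hv with hv | hv
    · exact hn2.2.2 hv (List.mem_cons_of_mem _ hv')
    · simp at hv; subst hv
      exact hn3.1 hv'
  intro x hx y hyH hyX hyp hxy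
  rw [List.mem_toFinset] at hx hyX
  obtain ⟨T₁, T₂, hT⟩ := List.append_of_mem hx
  obtain ⟨S₁, s, S₂, hS, hs, hS0⟩ := exists_last_split (l := p :: T₁) (q := G.Adj z)
    ⟨p, by simp, hp⟩
  obtain ⟨R, hR⟩ : ∃ R, p :: R = S₁ ++ [s] := by
    cases S₁ with
    | nil => simp at hS; exact ⟨[], by simp [hS]⟩
    | cons b S₁ => simp at hS; exact ⟨S₁ ++ [s], by simp [hS]⟩
  have hpT : p :: (T ++ [z]) = (S₁ ++ [s]) ++ (S₂ ++ x :: T₂) := by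
    rw [hT, ← List.cons_append, hS]; simp
  obtain ⟨N, hN⟩ : ∃ N, x :: T₂ = N ++ [z] := by
    rcases List.eq_nil_or_concat' (x :: T₂) with h0 | ⟨N, b, h0⟩
    · simp at h0
    · refine ⟨N, ?_⟩
      rw [h0, ← List.append_assoc] at hT
      have := List.append_inj_right' hT rfl
      simp at this
      rw [h0, this]
  have hnp := hn2.2.1
  rw [hpT] at hnp hc2
  have hnp2 := List.nodup_append'.1 hnp
  have hnp3 := List.nodup_append'.1 hnp2.2.1
  have hc3 := (List.isChain_append.1 hc2)
  have hc4 := (List.isChain_append.1 hc3.2.1)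
  have hTeq : T ++ [z] = R ++ (S₂ ++ x :: T₂) := by
    rw [← hR] at hpT
    simpa using hpT
  have hsub : ∀ r ∈ R ++ (x :: T₂).reverse, r ∈ T ++ [z] := by
    intro r hr
    rw [hTeq]
    simp at hr ⊢
    tauto
  have hnR : (p :: R ++ (x :: T₂).reverse).Nodup := by
    rw [hR]
    refine List.nodup_append'.2 ⟨hnp2.1, List.nodup_reverse.2 hnp3.2.1, ?_⟩
    intro v hv hv'
    exact hnp2.2.2 hv (List.mem_append_right _ (List.mem_reverse.1 hv'))
  refine ⟨R ++ (x :: T₂).reverse, fun r hr => List.mem_toFinset.2 (hsub r hr),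
    (List.nodup_cons.1 hnR).2, ?_, ?_, by simp⟩
  · have e : p :: (R ++ (x :: T₂).reverse ++ [y]) =
        S₁ ++ s :: ((x :: T₂).reverse ++ [y]) := by
      rw [← List.cons_append, ← List.cons_append, hR]; simp
    have e1 : s :: ((x :: T₂).reverse ++ [y]) = ([y] ++ x :: (T₂ ++ [s])).reverse := by simp
    rw [e]
    refine List.isChain_split.2 ⟨hc3.1, ?_⟩
    rw [e1, isChain_reverse_adj]
    refine List.isChain_split.2 ⟨by simpa using hxy.symm, ?_⟩
    have e2 : x :: (T₂ ++ [s]) = N ++ z :: [s] := by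
      rw [← List.cons_append, hN]; simp
    rw [e2, List.isChain_split, ← hN]
    exact ⟨hc4.2.1, by simpa using hs⟩
  · have hlenS : (S₁ ++ [s]).length % 2 = 1 := by
      refine (color_last hbip hc3.1 (a := p) (b := s) ?_ (by simp)).1 ?_
      · rw [← hR]; simp
      · rw [hbip _ _ hp, hbip _ _ hs]
    have b1 : (S₁ ++ [s]).countP (fun v => col v = !col z) = ((S₁ ++ [s]).length + 1) / 2 := by
      have := (countP_color hbip hc3.1 (a := p) (by rw [← hR]; simp)).1
      rwa [hbip _ _ hp] at this
    have b2 : (x :: T₂).countP (fun v => col v = !col z) = (x :: T₂).length / 2 := by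
      have := (countP_color hbip (isChain_reverse_adj.2 hc4.2.1) (a := z) (by rw [hN]; simp)).2
      rwa [List.countP_reverse, List.length_reverse] at this
    have hle : (nb G H z).card ≤ (((S₁ ++ [s]) ++ (x :: T₂)).filter
        fun v => col v = !col z).toFinset.card := by
      refine card_le_card fun v hv => ?_
      rw [List.mem_toFinset, List.mem_filter]
      refine ⟨?_, by simpa using hbip _ _ (mem_nb.1 hv).2⟩
      have h1 := hzP v hv
      have hvz := (mem_nb.1 hv).2
      rw [hfull] at h1
      rcases List.mem_append.1 h1 with h1 | h1
      · exact absurd hvz (hL0 v h1)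
      rw [hpT] at h1
      rcases List.mem_append.1 h1 with h1 | h1
      · exact List.mem_append_left _ h1
      rcases List.mem_append.1 h1 with h1 | h1
      · exact absurd hvz (hS0 v h1)
      · exact List.mem_append_right _ h1
    have h2 := hle.trans (List.toFinset_card_le _)
    rw [← List.countP_eq_length_filter, List.countP_append, b1, b2] at h2
    have h3 := congrArg List.length hR
    simp at h3 h2 hlenS ⊢
    omega

end

section

open scoped Classical

variable {V : Type*} [Fintype V] {G : SimpleGraph V} {c : ℕ} {col : V → Bool} {f : ℤ → V}

/-- Edges inside `H` with at least one endpoint in `S`. -/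
noncomputable def edges (G : SimpleGraph V) (S H : Finset V) : Finset (Sym2 V) :=
  univ.filter fun e => e ∈ G.edgeSet ∧ (∀ v ∈ e, v ∈ H) ∧ ∃ v ∈ e, v ∈ S

/-- Number of vertices of colour `b` in `S`. -/
noncomputable def cnt (col : V → Bool) (b : Bool) (S : Finset V) : ℕ :=
  (S.filter fun v => col v = b).card

theorem mem_edges {S H : Finset V} {u v : V} : s(u, v) ∈ edges G S H ↔
    G.Adj u v ∧ (u ∈ H ∧ v ∈ H) ∧ (u ∈ S ∨ v ∈ S) := by
  simp [edges, Sym2.mem_iff]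

omit [Fintype V] in
theorem cnt_flip (b : Bool) (S : Finset V) : cnt (fun v => !col v) b S = cnt col (!b) S := by
  unfold cnt
  congr 1
  ext v
  cases b <;> simp

theorem card_edges_le_of_attached (hbip : ∀ u v, G.Adj u v → col v = !col u) {X H : Finset V}
    {v : V} (h : ∀ x ∈ X, ∀ y ∈ H, y ∉ X → G.Adj x y → y = v) :
    (edges G X H).card ≤
      cnt col true X * cnt col false X + max (cnt col true X) (cnt col false X) := by
  have hsub : edges G X H ⊆
      ((X.filter fun v => col v = true) ×ˢ (X.filter fun v => col v = false)).image
        (fun p => s(p.1, p.2)) ∪ (X.filter fun x => col x = !col v).image (fun x => s(v, x)) := by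
    have key : ∀ x y, x ∈ X → y ∈ H → G.Adj x y → s(x, y) ∈
      ((X.filter fun v => col v = true) ×ˢ (X.filter fun v => col v = false)).image
        (fun p => s(p.1, p.2)) ∪ (X.filter fun x => col x = !col v).image (fun x => s(v, x)) := by
      intro x y hx hy hxy
      have hc := hbip x y hxy
      by_cases hyX : y ∈ X
      · refine mem_union_left _ (mem_image.2 ?_)
        cases hcx : col x
        · exact ⟨(y, x), by simp [hx, hyX, hcx, hc], Sym2.eq_swap⟩
        · exact ⟨(x, y), by simp [hx, hyX, hcx, hc], rfl⟩
      · obtain rfl := h x hx y hy hyX hxy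
        exact mem_union_right _ (mem_image.2 ⟨x, by simp [hx, hc], Sym2.eq_swap⟩)
    intro e
    induction e with
    | _ x y =>
      intro he
      rw [mem_edges] at he
      obtain ⟨h1, ⟨h2, h3⟩, h4 | h4⟩ := he
      · exact key x y h4 h3 h1
      · rw [Sym2.eq_swap]; exact key y x h4 h2 h1.symm
  refine (card_le_card hsub).trans ((card_union_le _ _).trans (add_le_add ?_ ?_))
  · exact card_image_le.trans (card_product _ _).le
  · refine card_image_le.trans ?_
    cases col v
    · exact le_max_left _ _
    · exact le_max_right _ _

theorem card_edges_le_sum (S H : Finset V) :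
    (edges G S H).card ≤ ∑ v ∈ S, (nb G H v).card := by
  have hsub : edges G S H ⊆ S.biUnion fun v => (nb G H v).image fun w => s(v, w) := by
    intro e
    induction e with
    | _ x y =>
      intro he
      rw [mem_edges] at he
      obtain ⟨h1, ⟨h2, h3⟩, h4 | h4⟩ := he
      · exact mem_biUnion.2 ⟨x, h4, mem_image.2 ⟨y, by simp [h1, h3], rfl⟩⟩
      · exact mem_biUnion.2 ⟨y, h4, mem_image.2 ⟨x, by simp [h1.symm, h2], Sym2.eq_swap⟩⟩
  exact (card_le_card hsub).trans (card_biUnion_le.trans (sum_le_sum fun v _ => card_image_le))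

theorem card_edges_le_sdiff (S W K : Finset V) :
    (edges G W (W ∪ K)).card ≤
      (edges G (W \ S) ((W \ S) ∪ K)).card + (edges G S (W ∪ K)).card := by
  refine (card_le_card (t := edges G (W \ S) ((W \ S) ∪ K) ∪ edges G S (W ∪ K)) ?_).trans
    (card_union_le _ _)
  intro e
  induction e with
  | _ x y =>
    simp only [mem_union, mem_edges, mem_sdiff]
    tauto

omit [Fintype V] in
theorem cnt_sdiff {S W : Finset V} (h : S ⊆ W) (b : Bool) :
    cnt col b (W \ S) + cnt col b S = cnt col b W := by
  unfold cnt
  rw [← card_union_of_disjoint]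
  · congr 1
    rw [← filter_union, sdiff_union_of_subset h]
  · exact disjoint_filter_filter sdiff_disjoint

theorem exists_longest {q : List V → Prop} (hq : ∀ l, q l → l.Nodup) (h : ∃ l, q l) :
    ∃ l, q l ∧ ∀ l', q l' → l'.length ≤ l.length := by
  have hb : ∀ n, (∃ l, q l ∧ l.length = n) → n ≤ Fintype.card V := by
    rintro n ⟨l, hl, rfl⟩
    exact (hq l hl).length_le_card
  obtain ⟨l₀, hl₀⟩ := h
  obtain ⟨l, hl, hlen⟩ := Nat.findGreatest_spec (P := fun n => ∃ l, q l ∧ l.length = n)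
    (hb _ ⟨l₀, hl₀, rfl⟩) ⟨l₀, hl₀, rfl⟩
  refine ⟨l, hl, fun l' hl' => ?_⟩
  rw [hlen]
  exact Nat.le_findGreatest (hb _ ⟨l', hl', rfl⟩) ⟨l', hl', rfl⟩

omit [Fintype V] in
theorem card_nb_union (W K : Finset V) (v : V) :
    (nb G (W ∪ K) v).card ≤ (nb G W v).card + (nb G K v).card := by
  refine (card_le_card (t := nb G W v ∪ nb G K v) fun w => ?_).trans (card_union_le _ _)
  simp only [mem_nb, mem_union]
  tauto

/-- A path in `W` whose first vertex has a neighbour on the cycle. -/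
def Attached (G : SimpleGraph V) (f : ℤ → V) (W : Finset V) (P : List V) : Prop :=
  P.Nodup ∧ P.IsChain G.Adj ∧ (∀ v ∈ P, v ∈ W) ∧ ∃ u ∈ P.head?, ∃ x ∈ cyc f, G.Adj u x

/-- An attached path of maximum length. -/
def LongestAttached (G : SimpleGraph V) (f : ℤ → V) (W : Finset V) (P : List V) : Prop :=
  Attached G f W P ∧ ∀ P', Attached G f W P' → P'.length ≤ P.length

theorem LongestAttached.nb_last {W : Finset V} {P : List V} (h : LongestAttached G f W P) {z : V}
    (hz : z ∈ P.getLast?) : ∀ v ∈ nb G W z, v ∈ P := by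
  intro v hv
  by_contra hvP
  obtain ⟨⟨h1, h2, h3, u, hu, x, hx, hux⟩, hmax⟩ := h
  rw [mem_nb] at hv
  have := hmax (P ++ [v]) ⟨?_, ?_, ?_, u, ?_, x, hx, hux⟩
  · simp at this
  · exact List.nodup_append'.2 ⟨h1, by simp, by simpa using hvP⟩
  · rw [List.isChain_append]
    refine ⟨h2, by simp, ?_⟩
    intro a ha b hb
    obtain rfl := Option.mem_unique ha hz
    simp at hb; subst hb
    exact hv.2
  · intro w hw
    rcases List.mem_append.1 hw with hw | hw
    · exact h3 w hw
    · simp at hw; subst hw; exact hv.1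
  · rw [List.head?_append, Option.mem_def.1 hu]; rfl

theorem Attached.of_last {W : Finset V} {P : List V} (h1 : P.Nodup) (h2 : P.IsChain G.Adj)
    (h3 : ∀ v ∈ P, v ∈ W) {z x : V} (hz : z ∈ P.getLast?) (hx : x ∈ cyc f) (hzx : G.Adj z x) :
    Attached G f W P.reverse :=
  ⟨by simpa using h1, isChain_reverse_adj.2 h2, by simpa using h3, z, by simpa using hz, x, hx, hzx⟩

theorem LongestAttached.reverse {W : Finset V} {P : List V} (h : LongestAttached G f W P)
    {z x : V} (hz : z ∈ P.getLast?) (hx : x ∈ cyc f) (hzx : G.Adj z x) :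
    LongestAttached G f W P.reverse :=
  ⟨Attached.of_last h.1.1 h.1.2.1 h.1.2.2.1 hz hx hzx, by simpa using h.2⟩

theorem LongCycle.ear_le_half (h : LongCycle G c col f) {x y : V} {Q : List V}
    (hQ : Ear G f x y Q) (hx : x ∈ cyc f) (hy : y ∈ cyc f) (hxy : x ≠ y) : Q.length + 1 ≤ c := by
  rw [mem_cyc] at hx hy
  obtain ⟨x, rfl⟩ := hx
  obtain ⟨y, rfl⟩ := hy
  have hc := h.two_le
  have hpos : (0 : ℤ) < 2 * c := by omega
  have hd : (2 * c : ℤ) ∣ y - x - (y - x) % (2 * c) := Int.dvd_self_sub_emod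
  have h1 := Int.emod_lt_of_pos (y - x) hpos
  have h2 := Int.emod_nonneg (y - x) hpos.ne'
  have h3 : (y - x) % (2 * c) ≠ 0 := by
    intro h0
    rw [h0, sub_zero] at hd
    exact hxy (h.congr_of_dvd hd).symm
  have l1 := h.ear_len_lt hQ (lt_of_le_of_ne h2 h3.symm) hd
  have l2 := h.ear_len_lt hQ.reverse (d := 2 * c - (y - x) % (2 * c)) (by omega) (by
    rw [show x - y - (2 * c - (y - x) % (2 * c)) = -((y - x - (y - x) % (2 * c)) + 2 * c) by ring]
    exact (dvd_add hd (dvd_refl _)).neg_right)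
  rw [List.length_reverse] at l2
  omega

/-- A set of outside vertices every nonempty subset of which meets many edges, relative to the
weights `α` of the colours. -/
structure Dense (G : SimpleGraph V) (c : ℕ) (col : V → Bool) (f : ℤ → V) (W : Finset V)
    (α : Bool → ℕ) : Prop where
  out : ∀ v ∈ W, v ∉ Set.range f
  cnt_le : ∀ b, cnt col b W ≤ c
  sum_eq : α true + α false = 2 * c + 2
  two_le : ∀ b, 2 ≤ α b
  dC_le : ∀ v ∈ W, 2 * dC G f v ≤ α (col v)
  dense : ∀ S ⊆ W, S.Nonempty → α true * cnt col true S + α false * cnt col false S <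
    2 * (edges G S (W ∪ cyc f)).card

namespace Dense

variable {W : Finset V} {α : Bool → ℕ}

theorem sum_not (h : Dense G c col f W α) (b : Bool) : α b + α (!b) = 2 * c + 2 := by
  have := h.sum_eq
  cases b <;> simp <;> omega

theorem deg (h : Dense G c col f W α) {v : V} (hv : v ∈ W) :
    α (col v) < 2 * (nb G (W ∪ cyc f) v).card := by
  have h1 := h.dense {v} (by simpa using hv) (singleton_nonempty v)
  have h2 := card_edges_le_sum (G := G) {v} (W ∪ cyc f)
  rw [sum_singleton] at h2
  refine lt_of_lt_of_le (lt_of_le_of_lt ?_ h1) (Nat.mul_le_mul_left 2 h2)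
  unfold cnt
  cases hc : col v <;> simp [filter_singleton, hc]

theorem link (h : Dense G c col f W α) (hbip : ∀ u v, G.Adj u v → col v = !col u) :
    ∀ X ⊆ W, X.Nonempty → ∀ v, ∃ x ∈ X, ∃ y ∈ W ∪ cyc f, y ∉ X ∧ y ≠ v ∧ G.Adj x y := by
  intro X hX hne v
  by_contra! hcon
  have h1 := card_edges_le_of_attached hbip (X := X) (H := W ∪ cyc f) (v := v)
    (fun x hx y hy hyX hxy => by
      by_contra hyv
      exact hcon x hx y hy hyX hyv hxy)
  have h2 := h.dense X hX hne
  have hp : cnt col true X ≤ c :=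
    (card_le_card (filter_subset_filter _ hX)).trans (h.cnt_le true)
  have hq : cnt col false X ≤ c :=
    (card_le_card (filter_subset_filter _ hX)).trans (h.cnt_le false)
  have ht := h.two_le true
  have hf := h.two_le false
  have hs := h.sum_eq
  generalize cnt col true X = p at *
  generalize cnt col false X = q at *
  generalize α true = A at *
  generalize α false = B at *
  rcases le_total p q with hpq | hpq
  · rw [max_eq_right hpq] at h1
    obtain ⟨r, rfl⟩ := Nat.exists_eq_add_of_le hpq
    nlinarith [Nat.mul_le_mul_left r hf, Nat.mul_le_mul_left r hp, Nat.mul_le_mul_left p hq]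
  · rw [max_eq_left hpq] at h1
    obtain ⟨r, rfl⟩ := Nat.exists_eq_add_of_le hpq
    nlinarith [Nat.mul_le_mul_left r ht, Nat.mul_le_mul_left r hq, Nat.mul_le_mul_left q hp]

theorem exists_longestAttached (h : Dense G c col f W α)
    (hbip : ∀ u v, G.Adj u v → col v = !col u) (hW : W.Nonempty) :
    ∃ P, LongestAttached G f W P := by
  refine exists_longest (fun l hl => hl.1) ?_
  obtain ⟨x, hx, y, hy, hyW, -, hxy⟩ := h.link hbip W Subset.rfl hW hW.choose
  refine ⟨[x], by simp, by simp, by simpa using hx, x, by simp, y, ?_, hxy⟩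
  exact (mem_union.1 hy).resolve_left hyW

theorem long_ear_or (h : Dense G c col f W α) (hL : LongCycle G c col f) {P : List V}
    (hP : LongestAttached G f W P) {u z : V} (hu : u ∈ P.head?) (hz : z ∈ P.getLast?) :
    (∃ x ∈ cyc f, ∃ y ∈ cyc f, x ≠ y ∧ ∃ Q, Ear G f x y Q ∧
      2 * (nb G (W ∪ cyc f) z).card ≤ Q.length + 2) ∨
    ∃ x ∈ nb G (cyc f) u, ∃ y ∈ nb G (cyc f) z, x ≠ y := by
  obtain ⟨h1, h2, h3, u', hu', x, hx, hux⟩ := hP.1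
  obtain rfl := Option.mem_unique hu hu'
  by_cases hcase : ∃ y ∈ nb G (cyc f) z, x ≠ y
  · obtain ⟨y, hy, hxy⟩ := hcase
    exact Or.inr ⟨x, by simpa using ⟨mem_cyc.1 hx, hux⟩, y, hy, hxy⟩
  push Not at hcase
  left
  have hxW : x ∉ W := fun hxW => h.out x hxW (mem_cyc.1 hx)
  obtain ⟨y, hy, hyW, hyx, Q, hQ0, hQ1, hQ2, hQ3, hQ4⟩ := exists_long_ear hL.bip
    (W := W) (H := W ∪ cyc f) (a := x) (z := z) (P := P) h3 (mem_union_right _ hx) hxW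
    subset_union_left (List.nodup_cons.2 ⟨fun hxP => hxW (h3 x hxP), h1⟩)
    (by
      rw [List.isChain_cons]
      refine ⟨fun v hv => ?_, h2⟩
      obtain rfl := Option.mem_unique hu hv
      exact hux.symm)
    (h.link hL.bip) hz (by
      intro v hv
      rw [mem_nb, mem_union] at hv
      obtain ⟨hv | hv, hzv⟩ := hv
      · exact List.mem_cons_of_mem _ (hP.nb_last hz v (mem_nb.2 ⟨hv, hzv⟩))
      · rw [← hcase v (mem_nb.2 ⟨hv, hzv⟩)]
        exact List.mem_cons_self)
  refine ⟨x, hx, y, (mem_union.1 hy).resolve_left hyW, hyx.symm, Q,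
    ⟨hQ0, hQ1, ?_, fun q hq => h.out q (hQ2 q hq), ?_, ?_⟩, hQ4⟩
  · rw [List.isChain_cons] at hQ3
    exact (List.isChain_append.1 hQ3.2).1
  · intro v hv
    rw [List.isChain_cons] at hQ3
    exact hQ3.1 v (by rw [List.head?_append, Option.mem_def.1 hv]; rfl)
  · intro v hv
    rw [List.isChain_cons] at hQ3
    exact (List.isChain_append.1 hQ3.2).2.2 v hv y (by simp)

variable [NeZero c]

theorem longest_odd (h : Dense G c col f W α) (hL : LongCycle G c col f) {P : List V}
    (hP : LongestAttached G f W P) {z : V} (hz : z ∈ P.getLast?) (hodd : P.length % 2 = 1)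
    (hα : c + 1 ≤ α (col z)) : 2 * (nb G (W ∪ cyc f) z).card = c + 2 ∧ α (col z) = c + 1 ∧
      (∃ y ∈ cyc f, G.Adj z y) ∧
      ∃ u w P', P = u :: w :: P' ∧ dC G f w = 0 ∧ (∀ v ∈ nb G W u, v ∈ P) ∧
        P.length = 2 * (nb G W u).card + 1 := by
  have hAtt := hP
  obtain ⟨⟨h1, h2, h3, u, hu, x, hx, hux⟩, hmax⟩ := hP
  have hzW : z ∈ W := h3 z (List.mem_of_getLast? hz)
  have huW : u ∈ W := h3 u (List.mem_of_mem_head? hu)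
  have dz := h.deg hzW
  have du := h.deg huW
  have hcol : col z = col u := (color_last hL.bip h2 hu hz).2 hodd
  rw [← hcol] at du
  rcases h.long_ear_or hL hAtt hu hz with ⟨x, hx, y, hy, hxy, Q, hQ, hQ'⟩ | ⟨x, hx, y, hy, hxy⟩
  · have := hL.ear_le_half hQ hx hy hxy
    omega
  have hy' := hy
  rw [mem_nb] at hy'
  have nz := hAtt.nb_last hz
  have hrev := hAtt.reverse hz hy'.1 hy'.2
  have nu : ∀ v ∈ nb G W u, v ∈ P := by
    intro v hv
    simpa using hrev.nb_last (z := u) (by simpa using hu) v hv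
  have cz := card_nb_last_le hL.bip h2 hz nz
  have cu := card_nb_head_le hL.bip h2 hu nu
  have tz := card_nb_union (G := G) W (cyc f) z
  have tu := card_nb_union (G := G) W (cyc f) u
  change _ ≤ _ + dC G f z at tz
  change _ ≤ _ + dC G f u at tu
  cases P with
  | nil => simp at hu
  | cons u' P =>
    simp at hu
    subst hu
    cases P with
    | nil =>
      have hd := h.dC_le u' huW
      rw [← hcol] at hd
      have cu0 : (nb G W u').card ≤ 0 := by simpa using cu
      omega
    | cons w P =>
      obtain ⟨l, hl⟩ : ∃ l, (u' :: w :: P).length = 2 * l + 1 :=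
        ⟨(u' :: w :: P).length / 2, by omega⟩
      have hl1 : 1 ≤ l := by simp at hl; omega
      rw [hl] at cu cz
      rcases hL.path_bound_odd h1 h2 (fun a ha => h.out a (h3 a ha)) hz hl hx hy hxy with
        ⟨r1, r2, r3, r4⟩ | r
      · have hprod : 2 * (l + dC G f u') ≤ dC G f u' * (l + 1) + 2 := by
          obtain ⟨d, hd⟩ := Nat.exists_eq_add_of_le r2
          obtain ⟨m, hm⟩ := Nat.exists_eq_add_of_le hl1
          rw [hd, hm]
          nlinarith
        refine ⟨by omega, by omega, ⟨y, hy'⟩, u', w, P, rfl, r4 (by omega), nu, by omega⟩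
      · omega

theorem false_of_longest_odd (h : Dense G c col f W α) (hL : LongCycle G c col f) {P : List V}
    (hP : LongestAttached G f W P) {z : V} (hz : z ∈ P.getLast?) (hodd : P.length % 2 = 1)
    (hα : c + 1 ≤ α (col z)) : False := by
  obtain ⟨-, hα1, ⟨y, hy, hzy⟩, u, w, P', rfl, hw, hu1, hu2⟩ := h.longest_odd hL hP hz hodd hα
  obtain ⟨⟨h1, h2, h3, -⟩, hmax⟩ := id hP
  have hcz : col z = col u := (color_last hL.bip h2 (by simp) hz).2 hodd
  have huw : G.Adj u w := (List.isChain_cons_cons.1 h2).1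
  have hwu : col w = !col u := hL.bip _ _ huw
  have hαw : α (col w) = c + 1 := by
    have := h.sum_not (col u)
    rw [hwu]; rw [hcz] at hα1; omega
  have hcolw : ∀ v ∈ nb G W w, col v = col z := by
    intro v hv
    rw [hL.bip _ _ (mem_nb.1 hv).2, hwu, hcz, Bool.not_not]
  have hwW : w ∈ W := h3 w (by simp)
  have hdeg : ∀ v ∈ nb G W w, 2 * (nb G (W ∪ cyc f) v).card = c + 2 := by
    intro v hv
    have hvz := hcolw v hv
    have hv' := mem_nb.1 hv
    by_cases hvP : v ∈ u :: w :: P'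
    · obtain ⟨M₁, M₂, hM⟩ := List.append_of_mem hvP
      have h2orig := h2
      rw [hM] at h1 h2 h3 hP hz hodd
      have n1 := List.nodup_append'.1 h1
      cases M₂ with
      | nil =>
        exact (h.longest_odd hL hP (z := v) (by simp) hodd (by rwa [hvz])).1
      | cons b M₂ =>
        have hub : G.Adj u b := by
          have hsub : nb G W u ⊆ ((u :: w :: P').filter fun v => col v = !col u).toFinset := by
            intro a ha
            rw [List.mem_toFinset, List.mem_filter]
            exact ⟨hu1 a ha, by simpa using hL.bip _ _ (mem_nb.1 ha).2⟩
          have hcard := (List.toFinset_card_le ((u :: w :: P').filter fun v => col v = !col u))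
          rw [← List.countP_eq_length_filter,
            (countP_color hL.bip h2orig (by simp)).2,
            hu2] at hcard
          have heq := eq_of_subset_of_card_le hsub (by omega)
          have hb : b ∈ nb G W u := by
            rw [heq, List.mem_toFinset, List.mem_filter]
            refine ⟨by rw [hM]; simp, ?_⟩
            have hvb : G.Adj v b := (List.isChain_cons_cons.1 (List.isChain_split.1 h2).2).1
            simp [hL.bip _ _ hvb, hvz, hcz]
          exact (mem_nb.1 hb).2
        have hnew : Attached G f W ((b :: M₂).reverse ++ (M₁ ++ [v])) := by
          refine ⟨?_, ?_, ?_, z, ?_, y, hy, hzy⟩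
          · rw [List.nodup_append', List.nodup_reverse]
            have e : M₁ ++ v :: b :: M₂ = (M₁ ++ [v]) ++ (b :: M₂) := by simp
            rw [e] at h1
            have n2 := List.nodup_append'.1 h1
            exact ⟨n2.2.1, n2.1, fun a ha ha' => n2.2.2 ha' (List.mem_reverse.1 ha)⟩
          · have e : M₁ ++ v :: b :: M₂ = (M₁ ++ [v]) ++ (b :: M₂) := by simp
            rw [e] at h2
            have c2 := List.isChain_append.1 h2
            rw [List.isChain_append, isChain_reverse_adj]
            refine ⟨c2.2.1, c2.1, ?_⟩
            intro s hs t ht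
            simp at hs
            subst hs
            have : t = u := by
              cases M₁ with
              | nil => simp at ht hM; rw [← ht, hM.1]
              | cons m M₁ => simp at ht hM; rw [← ht, hM.1]
            rw [this]
            exact hub.symm
          · intro a ha
            apply h3
            simp at ha ⊢
            tauto
          · rw [List.head?_append, List.head?_reverse]
            have e : M₁ ++ v :: b :: M₂ = (M₁ ++ [v]) ++ (b :: M₂) := by simp
            rw [e, List.getLast?_append_of_ne_nil _ (by simp)] at hz
            rw [Option.mem_def.1 hz]; rfl
        have hlen : ((b :: M₂).reverse ++ (M₁ ++ [v])).length = (M₁ ++ v :: b :: M₂).length := by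
          simp; omega
        refine (h.longest_odd hL (P := (b :: M₂).reverse ++ (M₁ ++ [v]))
          ⟨hnew, fun P'' hP'' => ?_⟩ (z := v) ?_ (by rw [hlen]; exact hodd) (by rwa [hvz])).1
        · rw [hlen]; exact hP.2 P'' hP''
        · rw [List.getLast?_append_of_ne_nil _ (by simp)]; simp
    · have hz' : z ∈ (v :: w :: P').getLast? := by
        cases P' with
        | nil => simp at hodd
        | cons b P' => simpa using hz
      have hnew : Attached G f W (v :: w :: P').reverse := by
        refine Attached.of_last ?_ ?_ ?_ hz' hy hzy
        · exact List.nodup_cons.2 ⟨fun hm => hvP (List.mem_cons_of_mem _ hm),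
            (List.nodup_cons.1 h1).2⟩
        · exact List.isChain_cons_cons.2 ⟨hv'.2.symm, (List.isChain_cons_cons.1 h2).2⟩
        · intro a ha
          rcases List.mem_cons.1 ha with rfl | ha
          · exact hv'.1
          · exact h3 a (List.mem_cons_of_mem _ ha)
      exact (h.longest_odd hL (P := (v :: w :: P').reverse)
        ⟨hnew, fun P'' hP'' => by simpa using hmax P'' hP''⟩ (z := v) (by simp)
        (by simp at hodd ⊢; omega) (by rwa [hvz])).1
  have hwN : w ∉ nb G W w := by simp
  have hS := h.dense (insert w (nb G W w)) (insert_subset hwW fun v hv => (mem_nb.1 hv).1)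
    ⟨w, mem_insert_self _ _⟩
  have hE : edges G (insert w (nb G W w)) (W ∪ cyc f) ⊆ edges G (nb G W w) (W ∪ cyc f) := by
    have key : ∀ y ∈ W ∪ cyc f, G.Adj w y → y ∈ nb G W w := by
      intro y hy hwy
      rcases mem_union.1 hy with hy | hy
      · exact mem_nb.2 ⟨hy, hwy⟩
      · have : nb G (cyc f) w = ∅ := card_eq_zero.1 hw
        have hmem : y ∈ nb G (cyc f) w := mem_nb.2 ⟨hy, hwy⟩
        rw [this] at hmem
        simp at hmem
    intro e
    induction e with
    | _ a b =>
      simp only [mem_edges, mem_insert]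
      rintro ⟨q1, ⟨q2, q3⟩, (rfl | q4) | (rfl | q4)⟩
      · exact ⟨q1, ⟨q2, q3⟩, Or.inr (key _ q3 q1)⟩
      · exact ⟨q1, ⟨q2, q3⟩, Or.inl q4⟩
      · exact ⟨q1, ⟨q2, q3⟩, Or.inl (key _ q2 q1.symm)⟩
      · exact ⟨q1, ⟨q2, q3⟩, Or.inr q4⟩
  have hE2 := (card_le_card hE).trans (card_edges_le_sum _ _)
  have hE3 : 2 * ∑ v ∈ nb G W w, (nb G (W ∪ cyc f) v).card = (nb G W w).card * (c + 2) := by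
    rw [mul_sum, sum_congr rfl hdeg, sum_const, smul_eq_mul]
  have hs : (nb G W w).card ≤ c := by
    refine le_trans (card_le_card fun v hv => ?_) (h.cnt_le (col z))
    exact mem_filter.2 ⟨(mem_nb.1 hv).1, hcolw v hv⟩
  have hα' : ∀ b, α b = c + 1 := by
    have := h.sum_eq
    have := h.sum_not (col z)
    intro b
    cases hb : col z <;> rw [hb] at hα1 <;> cases b <;> omega
  rw [hα', hα', ← mul_add] at hS
  have hcnt : cnt col true (insert w (nb G W w)) + cnt col false (insert w (nb G W w)) =
      (nb G W w).card + 1 := by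
    rw [← card_insert_of_notMem hwN, ← card_filter_add_card_filter_not (fun v => col v = true)]
    simp [cnt]
  rw [hcnt] at hS
  nlinarith

end Dense

end

section

open scoped Classical

variable {V : Type*} [Fintype V] {G : SimpleGraph V} {c : ℕ} {col : V → Bool} {f : ℤ → V}
  [NeZero c]

theorem LongCycle.path_bound_of_opposite (h : LongCycle G c col f) {P : List V} {u z v : V}
    {l : ℕ} (hn : P.Nodup) (hP : P.IsChain G.Adj) (ho : ∀ a ∈ P, a ∉ Set.range f)
    (hu : u ∈ P.head?) (hz : z ∈ P.getLast?) (hl : P.length = 2 * l + 1)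
    (hv : v ∉ Set.range f) (hvu : col v = !col u) (hu1 : 0 < dC G f u) (hz1 : 2 ≤ dC G f z) :
    dC G f z + l + dC G f v ≤ c + 1 ∨ dC G f v = 0 ∨ min c (dC G f u + l) + dC G f v ≤ c := by
  wlog hc : col v = true generalizing col f
  · have := this h.flip (by rwa [LongCycle.range_flip]) (by rwa [LongCycle.range_flip])
      (by simp [hvu]) (by rwa [dC_flip]) (by rwa [dC_flip]) (by simp [hc])
    simpa [dC_flip] using this
  have hcu : col u = false := by rw [hvu] at hc; simpa using hc
  have hcz : col z = false := by
    rw [← hcu, color_last h.bip hP hu hz, hl]; omega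
  have e0 : dC G f v = (idx G c f v).card := h.card_idx hc
  have e1 : dC G f u = (idx G c (fun i => f (i + 1)) u).card := by
    rw [← dC_flip]; exact h.flip.card_idx (by simp [hcu])
  have e2 : dC G f z = (idx G c (fun i => f (i + 1)) z).card := by
    rw [← dC_flip]; exact h.flip.card_idx (by simp [hcz])
  have hle : (idx G c f v).card ≤ c := (card_le_univ _).trans (ZMod.card c).le
  have hcompl : (idx G c f v)ᶜ.card = c - (idx G c f v).card := by
    rw [card_compl, ZMod.card]
  rw [e0, e1, e2]
  rw [e1] at hu1
  rw [e2] at hz1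
  have tri : ∀ a ∈ idx G c (fun i => f (i + 1)) u,
      (idx G c (fun i => f (i + 1)) z).card - 1 + l ≤ (idx G c f v)ᶜ.card ∨
      (idx G c f v)ᶜ = univ ∨ ∀ s : ℕ, s ≤ l → a - s ∈ (idx G c f v)ᶜ := by
    intro a ha
    have hpe := pred_card_le_card_erase (s := idx G c (fun i => f (i + 1)) z) (a := a)
    have hear : ∀ a ∈ idx G c (fun i => f (i + 1)) u,
        ∀ b ∈ (idx G c (fun i => f (i + 1)) z).erase a, ∃ a' b' : ℤ, (a' : ZMod c) = a ∧
        (b' : ZMod c) = b ∧ Ear G f (f (2 * a' + 2)) (f (2 * b' + 2)) P := by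
      intro a ha b hb
      obtain ⟨a, rfl⟩ := ZMod.intCast_surjective a
      obtain ⟨b, rfl⟩ := ZMod.intCast_surjective b
      have hb := mem_of_mem_erase hb
      rw [h.flip.mem_idx] at ha hb
      rw [add_assoc] at ha hb
      exact ⟨a, b, rfl, rfl, h.ear_of_path hn hP ho hu hz ha hb⟩
    refine (card_miss_trichotomy (Y := (idx G c (fun i => f (i + 1)) z).erase a)
      (Miss := (idx G c f v)ᶜ) (card_pos.1 (by omega)) a l ?_ ?_).imp (fun t => by omega) id
    · intro b hb s t hst
      obtain ⟨a, b, rfl, rfl, hE⟩ := hear a ha b hb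
      by_contra! hcon
      simp only [mem_compl, not_not] at hcon
      have h1 := (h.mem_idx v (a - s)).1 (by push_cast at hcon ⊢; exact hcon.1)
      have h2 := (h.mem_idx v (b - t)).1 (by push_cast at hcon ⊢; exact hcon.2)
      refine h.not_adj_pair hE ?_ hv (i := 1 + 2 * s) (j := 1 + 2 * t) (by omega)
        (by omega) (by omega) ?_ ?_
      · intro e
        apply ne_of_mem_erase hb
        rw [ZMod.intCast_eq_intCast_iff_dvd_sub]
        have := (h.inj _ _).1 e
        rw [show 2 * a + 2 - (2 * b + 2) = 2 * (a - b) by ring] at this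
        exact Int.dvd_of_mul_dvd_mul_left (by norm_num) this
      · convert h1 using 2; push_cast; ring
      · convert h2 using 2; push_cast; ring
    · intro b hb s t hs ht e
      obtain ⟨a, b, rfl, rfl, hE⟩ := hear a ha b hb
      have hdv := dvd_of_cast_eq (c := c) (a := a - s) (b := b - t) (by
        push_cast at e ⊢; exact e)
      have hst : s ≠ t := by
        rintro rfl
        exact ne_of_mem_erase hb (sub_left_injective e).symm
      have := h.ear_dist hE (d := 2 * t - 2 * s) (by omega) (by convert hdv using 1; ring)
      have h2 : |2 * (t : ℤ) - 2 * s| ≤ 2 * l := abs_le.2 ⟨by omega, by omega⟩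
      omega
  by_cases h1 : (idx G c (fun i => f (i + 1)) z).card - 1 + l ≤ (idx G c f v)ᶜ.card
  · left; omega
  by_cases h2 : (idx G c f v)ᶜ = univ
  · right; left
    have h0 : (idx G c f v) = ∅ := by simpa using congrArg compl h2
    rw [h0, card_empty]
  right; right
  have hsub : back (idx G c (fun i => f (i + 1)) u) l ⊆ (idx G c f v)ᶜ := by
    intro x hx
    obtain ⟨a, ha, s, hs, rfl⟩ := mem_back.1 hx
    exact ((tri a ha).resolve_left h1).resolve_left h2 s hs
  have := (le_card_back (card_pos.1 hu1) l).trans (card_le_card hsub)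
  omega

theorem Dense.false_of_nonempty {W : Finset V} {α : Bool → ℕ} (h : Dense G c col f W α)
    (hL : LongCycle G c col f) (hW : W.Nonempty)
    (hα : ∀ b, α b ≤ c → ∃ v, v ∉ Set.range f ∧ col v = !b ∧ α (!b) = 2 * dC G f v) : False := by
  obtain ⟨P, hP⟩ := h.exists_longestAttached hL.bip hW
  obtain ⟨h1, h2, h3, u, hu, -⟩ := hP.1
  obtain ⟨z, hz⟩ : ∃ z, z ∈ P.getLast? := by
    refine ⟨_, List.getLast?_eq_some_getLast ?_⟩
    rintro rfl
    simp at hu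
  have hzW : z ∈ W := h3 z (List.mem_of_getLast? hz)
  have huW : u ∈ W := h3 u (List.mem_of_mem_head? hu)
  have dz := h.deg hzW
  have du := h.deg huW
  have hs := h.sum_not (col z)
  rcases h.long_ear_or hL hP hu hz with ⟨x, hx, y, hy, hxy, Q, hQ, hQ'⟩ | ⟨x, hx, y, hy, hxy⟩
  · have := hL.ear_le_half hQ hx hy hxy
    obtain ⟨v, hv, -, hv'⟩ := hα (col z) (by omega)
    rw [mem_cyc] at hx hy
    obtain ⟨x, rfl⟩ := hx
    obtain ⟨y, rfl⟩ := hy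
    have := hL.dC_add_half_ear_le hQ hxy hv
    omega
  have hy' := mem_nb.1 hy
  have hx' := mem_nb.1 hx
  have nz := hP.nb_last hz
  have hrev := hP.reverse hz hy'.1 hy'.2
  have nu : ∀ v ∈ nb G W u, v ∈ P := by
    intro v hv
    simpa using hrev.nb_last (z := u) (by simpa using hu) v hv
  have cz := card_nb_last_le hL.bip h2 hz nz
  have cu := card_nb_head_le hL.bip h2 hu nu
  have tz := card_nb_union (G := G) W (cyc f) z
  have tu := card_nb_union (G := G) W (cyc f) u
  change _ ≤ _ + dC G f z at tz
  change _ ≤ _ + dC G f u at tu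
  have hout : ∀ a ∈ P, a ∉ Set.range f := fun a ha => h.out a (h3 a ha)
  have pz : 0 < dC G f z := card_pos.2 ⟨y, hy⟩
  have pu : 0 < dC G f u := card_pos.2 ⟨x, hx⟩
  have hcol := color_last hL.bip h2 hu hz
  by_cases hodd : P.length % 2 = 1
  · by_cases hbig : c + 1 ≤ α (col z)
    · exact h.false_of_longest_odd hL hP hz hodd hbig
    obtain ⟨v, hv, hvz, hv'⟩ := hα (col z) (by omega)
    obtain ⟨l, hl⟩ : ∃ l, P.length = 2 * l + 1 := ⟨P.length / 2, by omega⟩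
    have hzu := hcol.2 hodd
    have hE := hL.ear_of_path h1 h2 hout hu hz hx'.2 hy'.2
    obtain ⟨i, rfl⟩ := mem_cyc.1 hx'.1
    obtain ⟨j, rfl⟩ := mem_cyc.1 hy'.1
    have hX := hL.dC_add_half_ear_le hE hxy hv
    rw [← hzu] at du
    have h2α := h.two_le (!col z)
    rcases hL.path_bound_of_opposite h1 h2 hout hu hz hl hv (by rw [hvz, hzu]) pu (by omega) with
      r | r | r
    · omega
    · omega
    · omega
  · have := hL.path_bound_even h1 h2 hout hu hz (by omega) pu pz
    have hzu : col u = !col z := by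
      have : col z ≠ col u := fun e => hodd (hcol.1 e)
      cases h1 : col z <;> cases h2 : col u <;> simp_all
    rw [hzu] at du
    omega

theorem LongCycle.card_edges_le_of_weights (hL : LongCycle G c col f) {O : Finset V}
    {α : Bool → ℕ} (hO : ∀ v ∈ O, v ∉ Set.range f) (hcnt : ∀ b, cnt col b O ≤ c)
    (hsum : α true + α false = 2 * c + 2) (h2 : ∀ b, 2 ≤ α b)
    (hd : ∀ v ∈ O, 2 * dC G f v ≤ α (col v))
    (hα : ∀ b, α b ≤ c → ∃ v, v ∉ Set.range f ∧ col v = !b ∧ α (!b) = 2 * dC G f v) :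
    2 * (edges G O (O ∪ cyc f)).card ≤ α true * cnt col true O + α false * cnt col false O := by
  induction O using Finset.strongInduction with
  | _ O ih =>
    by_contra! hcon
    have hne : O.Nonempty := by
      by_contra hO
      rw [not_nonempty_iff_eq_empty] at hO
      subst hO
      simp [edges] at hcon
    refine Dense.false_of_nonempty (W := O) (α := α) ⟨hO, hcnt, hsum, h2, hd, ?_⟩ hL hne hα
    intro S hS hSne
    have hlt : O \ S ⊂ O := sdiff_ssubset hS hSne
    have key := ih (O \ S) hlt (fun v hv => hO v (hlt.1 hv))
      (fun b => (card_le_card (filter_subset_filter _ hlt.1)).trans (hcnt b))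
      (fun v hv => hd v (hlt.1 hv))
    have hE := card_edges_le_sdiff (G := G) S O (cyc f)
    have ct := cnt_sdiff (col := col) hS true
    have cf := cnt_sdiff (col := col) hS false
    rw [← ct, ← cf] at hcon
    rw [mul_add, mul_add] at hcon
    omega

theorem LongCycle.dC_le (hL : LongCycle G c col f) (v : V) : dC G f v ≤ c := by
  wlog hc : col v = true generalizing col f
  · have := this hL.flip (by simp [hc])
    rwa [dC_flip] at this
  rw [dC, hL.card_idx hc]
  exact (card_le_univ _).trans (ZMod.card c).le

theorem LongCycle.card_edges_le_of_cnt_le (hL : LongCycle G c col f) {O : Finset V}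
    (hO : ∀ v ∈ O, v ∉ Set.range f) (hcnt : ∀ b, cnt col b O ≤ c) :
    (edges G O (O ∪ cyc f)).card ≤ c * (c + 1) := by
  have fin : ∀ α : Bool → ℕ, α true + α false = 2 * c + 2 →
      2 * (edges G O (O ∪ cyc f)).card ≤ α true * cnt col true O + α false * cnt col false O →
      (edges G O (O ∪ cyc f)).card ≤ c * (c + 1) := by
    intro α hs hle
    have h1 := Nat.mul_le_mul_left (α true) (hcnt true)
    have h2 := Nat.mul_le_mul_left (α false) (hcnt false)
    have : α true * c + α false * c = 2 * (c * (c + 1)) := by rw [← add_mul, hs]; ring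
    omega
  have hc := hL.two_le
  by_cases hA : ∀ v ∈ O, 2 * dC G f v ≤ c + 1
  · exact fin (fun _ => c + 1) (by ring)
      (hL.card_edges_le_of_weights (α := fun _ => c + 1) hO hcnt (by ring)
      (fun b => by omega) hA (fun b hb => by omega))
  push Not at hA
  obtain ⟨v₀, hv₀, hd₀⟩ := hA
  obtain ⟨v, hv, hmax⟩ := exists_max_image O (dC G f) ⟨v₀, hv₀⟩
  have hvd := hmax v₀ hv₀
  have hdc := hL.dC_le v
  obtain ⟨α, hαdef⟩ : ∃ α : Bool → ℕ, ∀ b, α b =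
    if b = col v then 2 * dC G f v else 2 * (c + 1 - dC G f v) := ⟨_, fun _ => rfl⟩
  have hα : α true + α false = 2 * c + 2 := by
    rw [hαdef, hαdef]
    cases col v <;> simp <;> omega
  refine fin α hα (hL.card_edges_le_of_weights hO hcnt hα ?_ ?_ ?_)
  · intro b
    rw [hαdef]
    split_ifs <;> omega
  · intro w hw
    rw [hαdef]
    split_ifs with hwv
    · have := hmax w hw
      omega
    · have := hL.dC_add_dC_le (hO w hw) (hO v hv) hwv
      omega
  · intro b hb
    refine ⟨v, hO v hv, ?_, ?_⟩
    · rw [hαdef] at hb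
      split_ifs at hb with hbv
      · omega
      · cases h1 : col v <;> cases b <;> simp_all
    · rw [hαdef] at hb ⊢
      split_ifs at hb with hbv
      · omega
      · rw [if_pos]
        cases h1 : col v <;> cases b <;> simp_all

end

section

open scoped Classical

variable {V : Type*} [Fintype V] {G : SimpleGraph V} {c : ℕ} {col : V → Bool} {f : ℤ → V}

omit [Fintype V] in
theorem LongCycle.card_nb_head_le_of_max (hL : LongCycle G c col f) {O : Finset V} {P : List V}
    {u : V} (hn : P.Nodup) (hP : P.IsChain G.Adj) (hu : u ∈ P.head?)
    (hsub : ∀ v ∈ nb G O u, v ∈ P) : (nb G O u).card ≤ c := by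
  by_cases hne : ∃ v ∈ P, v ∈ nb G O u
  · obtain ⟨A, w, B, rfl, hw, hB⟩ := exists_last_split hne
    have e : A ++ w :: B = (A ++ [w]) ++ B := by simp
    rw [e] at hn hP
    have hn' := (List.nodup_append'.1 hn).1
    have hP' := (List.isChain_append.1 hP).1
    have huw : G.Adj u w := (mem_nb.1 hw).2
    have hu' : u ∈ (A ++ [w]).head? := by
      cases A with
      | nil => simpa using hu
      | cons a A => simpa using hu
    have h1 := card_nb_head_le hL.bip hP' hu' (H := O) (by
      intro v hv
      have := hsub v hv
      rw [e] at this
      exact (List.mem_append.1 this).resolve_right fun hvB => hB v hvB hv)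
    have h2 := hL.max _ hn' hP' (by
      intro a ha b hb
      obtain rfl := Option.mem_unique ha hu'
      simp at hb
      subst hb
      exact huw.symm)
    omega
  · push Not at hne
    have : nb G O u = ∅ := eq_empty_of_forall_notMem fun v hv => hne v (hsub v hv) hv
    simp [this]

variable [NeZero c]

theorem LongCycle.false_of_path_odd (hL : LongCycle G c col f) {O : Finset V} {P : List V}
    {u z : V} (hO : ∀ v ∈ O, v ∉ Set.range f) (hn : P.Nodup) (hP : P.IsChain G.Adj)
    (hPO : ∀ v ∈ P, v ∈ O) (hu : u ∈ P.head?) (hz : z ∈ P.getLast?) (hodd : P.length % 2 = 1)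
    (nu : ∀ v ∈ nb G O u, v ∈ P) (nz : ∀ v ∈ nb G O z, v ∈ P)
    (du : c + 1 ≤ (nb G (O ∪ cyc f) u).card) (dz : c + 1 ≤ (nb G (O ∪ cyc f) z).card) :
    False := by
  have cu := card_nb_head_le hL.bip hP hu nu
  have cz := card_nb_last_le hL.bip hP hz nz
  have cu' := hL.card_nb_head_le_of_max hn hP hu nu
  have cz' := hL.card_nb_head_le_of_max (P := P.reverse) (u := z) (O := O) (by simpa using hn)
    (isChain_reverse_adj.2 hP) (by simpa using hz) (by simpa using nz)
  have tz := card_nb_union (G := G) O (cyc f) z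
  have tu := card_nb_union (G := G) O (cyc f) u
  have hout : ∀ a ∈ P, a ∉ Set.range f := fun a ha => hO a (hPO a ha)
  obtain ⟨x, hx⟩ := card_pos.1 (show 0 < (nb G (cyc f) u).card by omega)
  obtain ⟨y, hy⟩ := card_pos.1 (show 0 < (nb G (cyc f) z).card by omega)
  change _ ≤ _ + dC G f z at tz
  change _ ≤ _ + dC G f u at tu
  by_cases hxy : ∃ x ∈ nb G (cyc f) u, ∃ y ∈ nb G (cyc f) z, x ≠ y
  · obtain ⟨x, hx, y, hy, hxy⟩ := hxy
    match P with
    | [] => simp at hu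
    | [a] =>
      have := hL.dC_le u
      simp at cu
      simp [cu] at tu
      omega
    | a :: w :: P =>
      simp at hu
      subst hu
      obtain ⟨l, hl⟩ : ∃ l, (a :: w :: P).length = 2 * l + 1 :=
        ⟨(a :: w :: P).length / 2, by omega⟩
      have hl1 : 1 ≤ l := by simp at hl; omega
      rcases hL.path_bound_odd hn hP hout hz hl hx hy hxy with ⟨-, r2, r3, -⟩ | r
      · have : l + dC G f a ≤ dC G f a * (l + 1) := by nlinarith
        omega
      · omega
  · push Not at hxy
    have hu1 : dC G f u ≤ 1 := card_le_one.2 fun a ha b hb =>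
      (hxy a ha y hy).trans (hxy b hb y hy).symm
    obtain rfl := hxy x hx y hy
    rw [mem_nb] at hx hy
    obtain ⟨⟨i, rfl⟩, hx⟩ := And.imp_left mem_cyc.1 hx
    have hc := hL.two_le
    have := hL.ear_len_lt (x := i) (y := i + 2 * c) (d := 2 * c) (by
      rw [hL.add_period]
      exact hL.ear_of_path hn hP hout hu hz hx hy.2) (by omega) (by simp)
    omega

theorem LongCycle.exists_card_nb_le (hL : LongCycle G c col f) {O : Finset V}
    (hO : ∀ v ∈ O, v ∉ Set.range f) (hne : O.Nonempty) :
    ∃ v ∈ O, (nb G (O ∪ cyc f) v).card ≤ c := by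
  by_contra! hcon
  obtain ⟨v₀, hv₀⟩ := hne
  obtain ⟨P, ⟨hP0, hn, hP, hPO⟩, hmax⟩ := exists_longest
    (q := fun P => P ≠ [] ∧ P.Nodup ∧ P.IsChain G.Adj ∧ ∀ v ∈ P, v ∈ O)
    (fun l hl => hl.2.1) ⟨[v₀], by simp, by simp, by simp, by simpa using hv₀⟩
  have ext : ∀ P : List V, P ≠ [] → P.Nodup → P.IsChain G.Adj → (∀ v ∈ P, v ∈ O) →
      (∀ P' : List V, (P' ≠ [] ∧ P'.Nodup ∧ P'.IsChain G.Adj ∧ ∀ v ∈ P', v ∈ O) →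
        P'.length ≤ P.length) → ∀ u ∈ P.head?, ∀ v ∈ nb G O u, v ∈ P := by
    intro P hP0 hn hP hPO hmax u hu v hv
    by_contra hvP
    rw [mem_nb] at hv
    have := hmax (v :: P) ⟨by simp, List.nodup_cons.2 ⟨hvP, hn⟩, ?_, ?_⟩
    · simp at this
    · rw [List.isChain_cons]
      refine ⟨fun a ha => ?_, hP⟩
      obtain rfl := Option.mem_unique ha hu
      exact hv.2.symm
    · simpa using ⟨hv.1, hPO⟩
  obtain ⟨u, hu⟩ : ∃ u, u ∈ P.head? := ⟨_, List.head?_eq_some_head hP0⟩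
  obtain ⟨z, hz⟩ : ∃ z, z ∈ P.getLast? := ⟨_, List.getLast?_eq_some_getLast hP0⟩
  have nu := ext P hP0 hn hP hPO hmax u hu
  have nz : ∀ v ∈ nb G O z, v ∈ P := by
    simpa using ext P.reverse (by simpa using hP0) (by simpa using hn)
      (isChain_reverse_adj.2 hP) (by simpa using hPO) (by simpa using hmax) z (by simpa using hz)
  have du := hcon u (hPO u (List.mem_of_mem_head? hu))
  have dz := hcon z (hPO z (List.mem_of_getLast? hz))
  by_cases hodd : P.length % 2 = 1
  · exact hL.false_of_path_odd hO hn hP hPO hu hz hodd nu nz du dz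
  have cu := card_nb_head_le hL.bip hP hu nu
  have cz := card_nb_last_le hL.bip hP hz nz
  have cu' := hL.card_nb_head_le_of_max hn hP hu nu
  have cz' := hL.card_nb_head_le_of_max (P := P.reverse) (u := z) (O := O) (by simpa using hn)
    (isChain_reverse_adj.2 hP) (by simpa using hz) (by simpa using nz)
  have tz := card_nb_union (G := G) O (cyc f) z
  have tu := card_nb_union (G := G) O (cyc f) u
  change _ ≤ _ + dC G f z at tz
  change _ ≤ _ + dC G f u at tu
  have := hL.path_bound_even hn hP (fun a ha => hO a (hPO a ha)) hu hz (by omega) (by omega)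
    (by omega)
  omega

omit [Fintype V] in
theorem exists_injOn_of_card_le_biUnion {A : Finset V} {t : V → Finset V}
    (h : ∀ S ⊆ A, S.card ≤ (S.biUnion t).card) :
    ∃ g : V → V, Set.InjOn g A ∧ ∀ x ∈ A, g x ∈ t x := by
  obtain ⟨g, hg, hgt⟩ := (all_card_le_biUnion_card_iff_exists_injective
    (fun x : A => t x)).1 (by
      intro s
      have := h (s.map (Function.Embedding.subtype _)) (by
        intro x hx
        obtain ⟨y, -, rfl⟩ := mem_map.1 hx
        exact y.2)
      rw [card_map] at this
      refine this.trans (card_le_card ?_)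
      intro x hx
      simpa using hx)
  refine ⟨fun x => if hx : x ∈ A then g ⟨x, hx⟩ else x, ?_, ?_⟩
  · intro x hx y hy hxy
    have hx' : x ∈ A := hx
    have hy' : y ∈ A := hy
    simp only [hx', hy', dif_pos] at hxy
    exact congrArg Subtype.val (hg hxy)
  · intro x hx
    simp only [hx, dif_pos]
    exact hgt ⟨x, hx⟩

omit [Fintype V] in
/-- A set violating Hall's condition as little as possible is matched with its neighbourhood,
except for a single vertex. -/
theorem exists_matching_of_card_lt {A B : Finset V} {t : V → Finset V} (ht : ∀ x ∈ A, t x ⊆ B)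
    (hAB : B.card < A.card) : ∃ Z ⊆ A, ∃ u ∈ Z, ∃ h : V → V, Set.InjOn h (Z.biUnion t) ∧
      ∀ w ∈ Z.biUnion t, h w ∈ Z ∧ h w ≠ u ∧ w ∈ t (h w) := by
  have hex : (A.powerset.filter fun S => (S.biUnion t).card < S.card).Nonempty := by
    by_contra hcon
    obtain ⟨g, hg, hgt⟩ := exists_injOn_of_card_le_biUnion (A := A) (t := t) (by
      intro S hS
      by_contra! hlt
      exact hcon ⟨S, by simp [hS, hlt]⟩)
    have := card_le_card_of_injOn g (fun x hx => ht x hx (hgt x hx)) hg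
    omega
  obtain ⟨Z, hZ, hmin⟩ := exists_min_image _ card hex
  simp only [mem_filter, mem_powerset] at hZ hmin
  obtain ⟨u, hu⟩ := card_pos.1 (show 0 < Z.card by omega)
  obtain ⟨g, hg, hgt⟩ := exists_injOn_of_card_le_biUnion (A := Z.erase u) (t := t) (by
    intro S hS
    by_contra! hlt
    have := hmin S ⟨(hS.trans (erase_subset _ _)).trans hZ.1, hlt⟩
    have h2 := card_le_card hS
    have h3 := card_erase_lt_of_mem hu
    omega)
  have hsurj : ∀ w ∈ Z.biUnion t, ∃ v ∈ Z.erase u, g v = w := by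
    have hmaps : Set.MapsTo g (Z.erase u) (Z.biUnion t) := fun x hx =>
      mem_biUnion.2 ⟨x, mem_of_mem_erase hx, hgt x hx⟩
    have := surjOn_of_injOn_of_card_le g hmaps hg (by
      rw [card_erase_of_mem hu]; omega)
    intro w hw
    exact this hw
  choose! h hh1 hh2 using hsurj
  refine ⟨Z, hZ.1, u, hu, h, ?_, fun w hw => ?_⟩
  · intro w hw w' hw' e
    rw [← hh2 w hw, ← hh2 w' hw', e]
  · have := hh1 w hw
    refine ⟨mem_of_mem_erase this, ne_of_mem_erase this, ?_⟩
    have := hgt _ this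
    rwa [hh2 w hw] at this

theorem LongCycle.exists_card_nb_le_of_cnt_lt (hL : LongCycle G c col f) {O : Finset V}
    (hO : ∀ v ∈ O, v ∉ Set.range f) {b : Bool} (hb : cnt col (!b) O < cnt col b O) :
    ∃ v ∈ O, col v = b ∧ (nb G (O ∪ cyc f) v).card ≤ c := by
  by_contra! hcon
  obtain ⟨Z, hZ, u, hu, h, hinj, hh⟩ := exists_matching_of_card_lt
    (A := O.filter fun v => col v = b) (B := O.filter fun v => col v = !b) (t := nb G O) (by
      intro x hx y hy
      rw [mem_filter] at hx ⊢
      rw [mem_nb] at hy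
      exact ⟨hy.1, by rw [hL.bip _ _ hy.2, hx.2]⟩) hb
  have hcZ : ∀ v ∈ Z, col v = b := fun v hv => (mem_filter.1 (hZ hv)).2
  have hOZ : ∀ v ∈ Z, v ∈ O := fun v hv => (mem_filter.1 (hZ hv)).1
  obtain ⟨P, ⟨hP0, hn, hP, hPO, hodd, hPh, hPl, h', hi, hm⟩, hmax⟩ := exists_longest
    (q := fun P => P ≠ [] ∧ P.Nodup ∧ P.IsChain G.Adj ∧ (∀ v ∈ P, v ∈ O) ∧ P.length % 2 = 1 ∧
      (∀ v ∈ P.head?, v ∈ Z) ∧ (∀ v ∈ P.getLast?, v ∈ Z) ∧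
      ∃ h : V → V, (∀ w ∈ Z.biUnion (nb G O), w ∉ P → ∀ w' ∈ Z.biUnion (nb G O), w' ∉ P →
        h w = h w' → w = w') ∧
        ∀ w ∈ Z.biUnion (nb G O), w ∉ P → h w ∈ Z ∧ h w ∉ P ∧ w ∈ nb G O (h w))
    (fun l hl => hl.2.1) ⟨[u], by simp, by simp, by simp, by simpa using hOZ u hu, by simp,
      by simpa using hu, by simpa using hu, h, fun w hw _ w' hw' _ e => hinj hw hw' e,
      fun w hw _ => by simpa using hh w hw⟩
  have ext : ∀ P : List V, P ≠ [] → P.Nodup → P.IsChain G.Adj → (∀ v ∈ P, v ∈ O) →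
      P.length % 2 = 1 → (∀ v ∈ P.head?, v ∈ Z) → (∀ v ∈ P.getLast?, v ∈ Z) →
      (∀ w ∈ Z.biUnion (nb G O), w ∉ P → ∀ w' ∈ Z.biUnion (nb G O), w' ∉ P →
        h' w = h' w' → w = w') →
      (∀ w ∈ Z.biUnion (nb G O), w ∉ P → h' w ∈ Z ∧ h' w ∉ P ∧ w ∈ nb G O (h' w)) →
      (∀ P' : List V, (P' ≠ [] ∧ P'.Nodup ∧ P'.IsChain G.Adj ∧ (∀ v ∈ P', v ∈ O) ∧
        P'.length % 2 = 1 ∧ (∀ v ∈ P'.head?, v ∈ Z) ∧ (∀ v ∈ P'.getLast?, v ∈ Z) ∧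
        ∃ h : V → V, (∀ w ∈ Z.biUnion (nb G O), w ∉ P' → ∀ w' ∈ Z.biUnion (nb G O), w' ∉ P' →
          h w = h w' → w = w') ∧
          ∀ w ∈ Z.biUnion (nb G O), w ∉ P' → h w ∈ Z ∧ h w ∉ P' ∧ w ∈ nb G O (h w)) →
        P'.length ≤ P.length) → ∀ z ∈ P.getLast?, ∀ v ∈ nb G O z, v ∈ P := by
    intro P hP0 hn hP hPO hodd hPh hPl hi hm hmax z hz w hw
    by_contra hwP
    have hzZ := hPl z hz
    have hwN : w ∈ Z.biUnion (nb G O) := mem_biUnion.2 ⟨z, hzZ, hw⟩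
    obtain ⟨v1, v2, v3⟩ := hm w hwN hwP
    rw [mem_nb] at hw v3
    have hcw : col w = !b := by rw [hL.bip _ _ hw.2, hcZ z hzZ]
    have hlen := hmax (P ++ [w, h' w]) ⟨by simp, ?_, ?_, ?_, ?_, ?_, ?_, h', ?_, ?_⟩
    · simp at hlen
    · refine List.nodup_append'.2 ⟨hn, by simpa using v3.2.ne.symm, ?_⟩
      intro a ha ha'
      simp at ha'
      rcases ha' with rfl | rfl
      · exact hwP ha
      · exact v2 ha
    · rw [List.isChain_append]
      refine ⟨hP, by simpa using v3.2.symm, ?_⟩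
      intro a ha a' ha'
      obtain rfl := Option.mem_unique ha hz
      simp at ha'
      subst ha'
      exact hw.2
    · intro a ha
      simp at ha
      rcases ha with ha | rfl | rfl
      · exact hPO a ha
      · exact hw.1
      · exact hOZ _ v1
    · simp; omega
    · intro a ha
      rw [List.head?_append_of_ne_nil _ hP0] at ha
      exact hPh a ha
    · intro a ha
      simp at ha
      subst ha
      exact v1
    · intro a ha haP a' ha' haP'
      simp at haP haP'
      exact hi a ha haP.1 a' ha' haP'.1
    · intro a ha haP
      simp at haP
      obtain ⟨m1, m2, m3⟩ := hm a ha haP.1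
      refine ⟨m1, ?_, m3⟩
      simp only [List.mem_append, List.mem_cons, List.not_mem_nil, or_false, not_or]
      refine ⟨m2, ?_, ?_⟩
      · intro e
        rw [← e, hcZ _ m1] at hcw
        simp at hcw
      · intro e
        exact haP.2.1 (hi a ha haP.1 w hwN hwP e)
  obtain ⟨a, ha⟩ : ∃ u, u ∈ P.head? := ⟨_, List.head?_eq_some_head hP0⟩
  obtain ⟨z, hz⟩ : ∃ z, z ∈ P.getLast? := ⟨_, List.getLast?_eq_some_getLast hP0⟩
  have nz := ext P hP0 hn hP hPO hodd hPh hPl hi hm hmax z hz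
  have na : ∀ v ∈ nb G O a, v ∈ P := by
    have := ext P.reverse (by simpa using hP0) (by simpa using hn)
      (isChain_reverse_adj.2 hP) (by simpa using hPO) (by simpa using hodd) (by simpa using hPl)
      (by simpa using hPh) (by simpa only [List.mem_reverse] using hi)
      (by simpa only [List.mem_reverse] using hm)
      (by simpa only [List.length_reverse] using hmax) a (by simpa using ha)
    simpa only [List.mem_reverse] using this
  exact hL.false_of_path_odd hO hn hP hPO ha hz hodd na nz
    (hcon a (hOZ _ (hPh a ha)) (hcZ _ (hPh a ha))) (hcon z (hOZ _ (hPl z hz)) (hcZ _ (hPl z hz)))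

theorem LongCycle.card_edges_le_of_le_cnt (hL : LongCycle G c col f) {O : Finset V}
    (hO : ∀ v ∈ O, v ∉ Set.range f) (hcnt : ∀ b, c ≤ cnt col b O) :
    (edges G O (O ∪ cyc f)).card ≤ c * (cnt col true O + cnt col false O + 1 - c) := by
  induction O using Finset.strongInduction with
  | _ O ih =>
    by_cases hsq : ∀ b, cnt col b O ≤ c
    · have := hL.card_edges_le_of_cnt_le hO hsq
      rw [le_antisymm (hsq true) (hcnt true), le_antisymm (hsq false) (hcnt false)]
      rwa [show c + c + 1 - c = c + 1 by omega]
    have hct := hcnt true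
    have hcf := hcnt false
    obtain ⟨v, hv, hvc, hvd⟩ : ∃ v ∈ O, c < cnt col (col v) O ∧
        (nb G (O ∪ cyc f) v).card ≤ c := by
      by_cases hne : ∃ b, cnt col (!b) O < cnt col b O
      · obtain ⟨b, hb⟩ := hne
        obtain ⟨v, hv, rfl, hd⟩ := hL.exists_card_nb_le_of_cnt_lt hO hb
        exact ⟨v, hv, (hcnt _).trans_lt hb, hd⟩
      push Not at hne hsq
      have e1 := hne true
      have e2 := hne false
      simp only [Bool.not_true, Bool.not_false] at e1 e2
      obtain ⟨b, hb⟩ := hsq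
      have hall : ∀ b, c < cnt col b O := by
        intro b'
        cases b <;> cases b' <;> omega
      obtain ⟨v₀, hv₀⟩ := card_pos.1 (show 0 < cnt col b O by omega)
      obtain ⟨v, hv, hd⟩ := hL.exists_card_nb_le hO ⟨v₀, (mem_filter.1 hv₀).1⟩
      exact ⟨v, hv, hall _, hd⟩
    have hsub : ({v} : Finset V) ⊆ O := by simpa using hv
    have hlt : O \ {v} ⊂ O := sdiff_ssubset hsub (singleton_nonempty v)
    have hS := fun b => cnt_sdiff (col := col) hsub b
    have h1 : ∀ b, cnt col b {v} = if col v = b then 1 else 0 := by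
      intro b
      unfold cnt
      rw [filter_singleton]
      split_ifs <;> simp
    have key := ih (O \ {v}) hlt (fun w hw => hO w (hlt.1 hw)) (by
      intro b
      have := hS b
      have := hcnt b
      rw [h1] at *
      split_ifs at * with hvb
      · subst hvb; omega
      · omega)
    have hE := card_edges_le_sdiff (G := G) {v} O (cyc f)
    have hE1 := card_edges_le_sum (G := G) {v} (O ∪ cyc f)
    rw [sum_singleton] at hE1
    have hsum : cnt col true (O \ {v}) + cnt col false (O \ {v}) + 1 =
        cnt col true O + cnt col false O := by
      rw [← hS true, ← hS false, h1, h1]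
      cases col v <;> simp <;> omega
    have : cnt col true O + cnt col false O + 1 - c =
        (cnt col true (O \ {v}) + cnt col false (O \ {v}) + 1 - c) + 1 := by
      omega
    rw [this, mul_add, mul_one]
    omega

end

section

open scoped Classical

variable {V : Type*} {G : SimpleGraph V} {c : ℕ} {col : V → Bool} {f : ℤ → V}

theorem LongCycle.card_cyc [Fintype V] (hL : LongCycle G c col f) : 2 * c ≤ (cyc f).card := by
  have := card_le_card_of_injOn (s := range (2 * c)) (t := cyc f) (fun k : ℕ => f k)
    (fun k _ => mem_cyc.2 ⟨_, rfl⟩) (by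
      intro i hi j hj hij
      simp at hi hj
      have := hL.eq_of_lt hij (by omega) (by omega)
      omega)
  simpa using this

theorem LongCycle.cnt_cyc_le [Fintype V] (hL : LongCycle G c col f) (b : Bool) :
    cnt col b (cyc f) ≤ c := by
  wlog hb : b = true generalizing col f b
  · have := this hL.flip (!b) (by simpa using hb)
    rwa [cyc_flip, cnt_flip, Bool.not_not] at this
  subst hb
  have hc := hL.two_le
  have hsub : (cyc f).filter (fun v => col v = true) ⊆ (range c).image fun k : ℕ => f (2 * k) := by
    intro v hv
    rw [mem_filter, mem_cyc] at hv
    obtain ⟨⟨i, rfl⟩, hi⟩ := hv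
    obtain ⟨j, rfl⟩ := (hL.par i).1 hi
    have hpos : (0 : ℤ) < c := by omega
    have h1 := Int.emod_nonneg j hpos.ne'
    have h2 := Int.emod_lt_of_pos j hpos
    refine mem_image.2 ⟨(j % c).toNat, by simp; omega, ?_⟩
    refine hL.congr_of_dvd ?_
    rw [Int.toNat_of_nonneg h1, show 2 * (j % c) - (j + j) = 2 * (-(j - j % c)) by ring]
    exact mul_dvd_mul_left 2 (Int.dvd_self_sub_emod).neg_right
  exact (card_le_card hsub).trans (card_image_le.trans (card_range c).le)

/-- A closed path on at least three vertices gives a cycle. -/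
theorem hasCycleLength_of_isChain {l : List V} (hn : l.Nodup) (hl : l.IsChain G.Adj)
    (hclose : ∀ a ∈ l.head?, ∀ b ∈ l.getLast?, G.Adj b a) (h3 : 3 ≤ l.length) :
    hasCycleLength G l.length := by
  have hne : l ≠ [] := by rintro rfl; simp at h3
  set p := SimpleGraph.Walk.ofSupport l hne hl with hp
  have hps : p.support = l := SimpleGraph.Walk.support_ofSupport hne hl
  have hpl : p.length = l.length - 1 := SimpleGraph.Walk.length_ofSupport hne hl
  have hpath : p.IsPath := SimpleGraph.Walk.IsPath.mk' (by rwa [hps])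
  have hadj := hclose _ (List.head?_eq_some_head hne) _ (List.getLast?_eq_some_getLast hne)
  refine ⟨_, SimpleGraph.Walk.cons hadj p,
    (SimpleGraph.Walk.cons_isCycle_iff p hadj).2 ⟨hpath, fun hmem => ?_⟩, ?_⟩
  · have := hpath.length_eq_one_of_mem_edges (by rwa [Sym2.eq_swap] at hmem)
    omega
  · rw [SimpleGraph.Walk.length_cons, hpl]
    omega

theorem longCycle_of_isCycle (hbip : ∀ u v, G.Adj u v → col v = !col u) {v : V}
    {p : G.Walk v v} (hp : p.IsCycle) (hlen : p.length = 2 * c)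
    (hmax : ∀ l : ℕ, hasCycleLength G l → l ≤ 2 * c) (hv : col v = true) :
    LongCycle G c col (fun i => p.getVert (i % (2 * c)).toNat) := by
  have hlen3 := hp.three_le_length
  have hc : 2 ≤ c := by omega
  have hpos : (0 : ℤ) < 2 * c := by omega
  have hlt : ∀ i : ℤ, ((i % (2 * c)).toNat : ℤ) = i % (2 * c) ∧ (i % (2 * c)).toNat < 2 * c := by
    intro i
    have h1 := Int.emod_nonneg i hpos.ne'
    have h2 := Int.emod_lt_of_pos i hpos
    omega
  have hcol : ∀ k ≤ 2 * c, (col (p.getVert k) = true ↔ Even k) := by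
    intro k
    induction k with
    | zero => simp [hv]
    | succ k ih =>
      intro hk
      have := ih (by omega)
      rw [hbip _ _ (p.adj_getVert_succ (i := k) (by omega)), Nat.even_add_one, ← this]
      simp
  refine ⟨hc, hbip, ?_, ?_, ?_, ?_⟩
  · intro i
    obtain ⟨h1, h2⟩ := hlt i
    have key := p.adj_getVert_succ (i := (i % (2 * c)).toNat) (by omega)
    by_cases hlast : (i % (2 * c)).toNat + 1 = 2 * c
    · have e : (i + 1) % (2 * c) = 0 := by
        rw [Int.add_emod, ← h1, show (((i % (2 * c)).toNat : ℤ)) = 2 * c - 1 by omega]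
        rw [Int.emod_eq_of_lt (a := 1) (by omega) (by omega)]
        simp
      rw [hlast, ← hlen, p.getVert_length] at key
      simpa [e] using key
    · have e : ((i + 1) % (2 * c)).toNat = (i % (2 * c)).toNat + 1 := by
        rw [Int.add_emod, ← h1, Int.emod_eq_of_lt (a := 1) (by omega) (by omega),
          Int.emod_eq_of_lt (by omega) (by omega)]
        omega
      simpa only [e] using key
  · intro i j
    rw [← Int.emod_eq_emod_iff_emod_sub_eq_zero.trans (Int.dvd_iff_emod_eq_zero).symm]
    constructor
    · intro h
      have hmem : ∀ i : ℤ, (i % (2 * c)).toNat ∈ {k | k ≤ p.length - 1} := fun i => by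
        have := (hlt i).2
        rw [Set.mem_ofPred_eq]
        omega
      have := hp.getVert_injOn' (hmem i) (hmem j) h
      rw [← (hlt i).1, ← (hlt j).1, this]
    · intro h
      simp only [h]
  · intro i
    obtain ⟨h1, h2⟩ := hlt i
    rw [hcol _ h2.le, Int.even_iff, Nat.even_iff]
    have : i % (2 * c) % 2 = i % 2 := Int.emod_emod_of_dvd i ⟨c, rfl⟩
    omega
  · intro l hn hl hclose
    by_cases h3 : 3 ≤ l.length
    · exact hmax _ (hasCycleLength_of_isChain hn hl hclose h3)
    · omega

theorem range_getVert_emod {v : V} {p : G.Walk v v} (hc : 0 < c) (hlen : p.length = 2 * c) :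
    Set.range (fun i : ℤ => p.getVert (i % (2 * c)).toNat) = {w | w ∈ p.support} := by
  ext w
  have hpos : (0 : ℤ) < 2 * c := by omega
  rw [Set.mem_range, Set.mem_ofPred_eq, SimpleGraph.Walk.mem_support_iff_exists_getVert]
  constructor
  · rintro ⟨i, rfl⟩
    have h1 := Int.emod_nonneg i hpos.ne'
    have h2 := Int.emod_lt_of_pos i hpos
    exact ⟨_, rfl, by omega⟩
  · rintro ⟨k, rfl, hk⟩
    rcases hk.lt_or_eq with hk | hk
    · refine ⟨k, ?_⟩
      rw [Int.emod_eq_of_lt (by omega) (by omega)]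
      simp
    · refine ⟨0, ?_⟩
      rw [hk, p.getVert_length]
      simp

theorem cnt_true_add_cnt_false (S : Finset V) : cnt col true S + cnt col false S = S.card := by
  rw [← card_filter_add_card_filter_not (fun w => col w = true)]
  simp [cnt]

theorem ncard_edges_outside_le [Fintype V] (hbip : ∀ u v, G.Adj u v → col v = !col u) {v : V}
    {p : G.Walk v v} (hp : p.IsCycle) (hlen : p.length = 2 * c)
    (hmax : ∀ l : ℕ, hasCycleLength G l → l ≤ 2 * c) (hv : col v = true)
    (hbig : ∀ b, 2 * c ≤ cnt col b univ) :
    Set.ncard {e : Sym2 V | e ∈ G.edgeSet ∧ ¬ ∀ w ∈ e, w ∈ p.support} ≤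
      c * (Fintype.card V + 1 - 3 * c) := by
  have hlen3 := hp.three_le_length
  have hc : 0 < c := by omega
  have : NeZero c := ⟨hc.ne'⟩
  have hL := longCycle_of_isCycle hbip hp hlen hmax hv
  have hrange := range_getVert_emod (p := p) hc hlen
  set f : ℤ → V := fun i => p.getVert (i % (2 * c)).toNat with hf
  have hmem : ∀ w, w ∈ cyc f ↔ w ∈ p.support := by
    intro w
    rw [mem_cyc, hrange]
    rfl
  have hsplit := cnt_sdiff (col := col) (subset_univ (cyc f))
  have huniv : cnt col true univ + cnt col false univ = Fintype.card V := cnt_true_add_cnt_false _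
  have hcyc := hL.card_cyc
  rw [← cnt_true_add_cnt_false (col := col)] at hcyc
  have t1 := hL.cnt_cyc_le true
  have t2 := hL.cnt_cyc_le false
  have hO : ∀ b, c ≤ cnt col b (univ \ cyc f) := by
    intro b
    have h1 := hsplit b
    have h2 := hbig b
    have h3 := hL.cnt_cyc_le b
    omega
  have key := hL.card_edges_le_of_le_cnt (O := univ \ cyc f)
    (fun w hw hw' => (mem_sdiff.1 hw).2 (mem_cyc.2 hw')) hO
  have hs1 := hsplit true
  have hs2 := hsplit false
  rw [show cnt col true (univ \ cyc f) + cnt col false (univ \ cyc f) + 1 - c =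
    Fintype.card V + 1 - 3 * c by omega, sdiff_union_of_subset (subset_univ _)] at key
  refine le_trans ?_ key
  rw [← Set.ncard_coe_finset]
  refine Set.ncard_le_ncard ?_ (Set.toFinite _)
  rintro e ⟨he, hne⟩
  induction e with
  | _ a b =>
    rw [mem_coe, mem_edges]
    simp only [Sym2.mem_iff, forall_eq_or_imp, forall_eq, not_and_or, ← hmem] at hne
    refine ⟨he, ⟨mem_univ _, mem_univ _⟩, ?_⟩
    simpa only [mem_sdiff, mem_univ, true_and] using hne

theorem cnt_isLeft_beq {n m : ℕ} (v : Fin n ⊕ Fin m) (b : Bool) :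
    cnt (fun w : Fin n ⊕ Fin m => w.isLeft == v.isLeft) b univ =
      if b = v.isLeft then n else m := by
  have hl : (univ.filter fun w : Fin n ⊕ Fin m => w.isLeft = true) =
      univ.map Function.Embedding.inl := by
    ext w; cases w <;> simp
  have hr : (univ.filter fun w : Fin n ⊕ Fin m => w.isRight = true) =
      univ.map Function.Embedding.inr := by
    ext w; cases w <;> simp
  cases v <;> cases b <;> simp [cnt, hl, hr]

end

end LiNing

/-- (Li–Ning) Let `G` be bipartite with parts of sizes `n ≥ m`, and `C` (given by the
closed walk `p`) a longest cycle with `2c` vertices, `c ≤ m`. If `m ≥ 2c`, then the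
number of edges with at least one endpoint outside `C` satisfies
`e(G - C) + e(G - C, C) ≤ c(m + n + 1 - 3c)`. -/
theorem li_ning_large (n m c : ℕ) (hmn : m ≤ n)
    (G : SimpleGraph (Fin n ⊕ Fin m))
    (hG : G ≤ completeBipartiteGraph (Fin n) (Fin m))
    (v : Fin n ⊕ Fin m) (p : G.Walk v v) (hp : p.IsCycle) (hplen : p.length = 2 * c)
    (hmax : ∀ l : ℕ, hasCycleLength G l → l ≤ 2 * c)
    (hcm : c ≤ m) (h2cm : 2 * c ≤ m) :
    Set.ncard {e : Sym2 (Fin n ⊕ Fin m) | e ∈ G.edgeSet ∧ ¬ ∀ w ∈ e, w ∈ p.support} ≤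
      c * (m + n + 1 - 3 * c) := by
  have hbip : ∀ u w, G.Adj u w → (w.isLeft == v.isLeft) = !(u.isLeft == v.isLeft) := by
    intro u w huw
    have := hG huw
    rw [completeBipartiteGraph_adj] at this
    cases u <;> cases w <;> cases v <;> simp_all
  have := LiNing.ncard_edges_outside_le (col := fun w => w.isLeft == v.isLeft) hbip hp hplen hmax
    (by simp) (fun b => by rw [LiNing.cnt_isLeft_beq]; split_ifs <;> omega)
  rwa [Fintype.card_sum, Fintype.card_fin, Fintype.card_fin, add_comm n] at this
end

section
/- Let m ≥ 5. If K_{2m,2m} is 2-colored (red/blue) with no monochromatic C_{2m}, then both the longest red cycle and the longest blue cycle have length at most 2(m−1). -/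
/-- A sequence indexed by `ℤ` that runs around a cycle of length `n` in `G`. -/
structure IsCyclicSeq {V : Type*} (G : SimpleGraph V) (n : ℤ) (v : ℤ → V) : Prop where
  periodic : ∀ i, v (i + n) = v i
  dvd_of_eq : ∀ i j, v i = v j → n ∣ i - j
  adj_succ : ∀ i, G.Adj (v i) (v (i + 1))

namespace IsCyclicSeq

variable {V : Type*} {G H : SimpleGraph V} {n : ℤ} {v : ℤ → V}

theorem shift (h : IsCyclicSeq G n v) (a : ℤ) : IsCyclicSeq G n fun i ↦ v (a + i) where
  periodic i := by rw [← add_assoc, h.periodic]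
  dvd_of_eq i j hij := by simpa using h.dvd_of_eq _ _ hij
  adj_succ i := by rw [← add_assoc]; exact h.adj_succ _

theorem eq_of_eq (h : IsCyclicSeq G n v) {i j : ℤ} (hij : v i = v j) (h1 : i - j < n)
    (h2 : j - i < n) : i = j := by
  have := Int.eq_zero_of_abs_lt_dvd (h.dvd_of_eq i j hij) (abs_lt.2 ⟨by omega, h1⟩)
  omega

theorem eq_of_dvd (h : IsCyclicSeq G n v) {i j : ℤ} (hij : n ∣ i - j) : v i = v j := by
  obtain ⟨k, hk⟩ := hij
  have := (show Function.Periodic v n from h.periodic).int_mul k j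
  rw [← this]
  congr 1
  push_cast
  linarith

theorem eq_of_eq_add (h : IsCyclicSeq G n v) {i j : ℤ} (hij : i = j + n) : v i = v j := by
  rw [hij, h.periodic]

/-- A cycle given by its vertices at the times `0, …, n - 1` extends periodically. -/
theorem exists_of_range {f : ℤ → V} (hn : 2 ≤ n)
    (hadj : ∀ i, 0 ≤ i → i + 1 < n → G.Adj (f i) (f (i + 1)))
    (hclose : G.Adj (f (n - 1)) (f 0))
    (hinj : ∀ i j, 0 ≤ i → i < j → j < n → f i ≠ f j) :
    ∃ w, IsCyclicSeq G n w ∧ ∀ i, 0 ≤ i → i < n → w i = f i := by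
  refine ⟨fun i ↦ f (i % n), ⟨fun i ↦ by simp, fun i j hij ↦ ?_, fun i ↦ ?_⟩,
    fun i h0 h1 ↦ by simp only [Int.emod_eq_of_lt h0 h1]⟩
  · have hi := Int.emod_nonneg i (show n ≠ 0 by omega)
    have hj := Int.emod_nonneg j (show n ≠ 0 by omega)
    have hi' := Int.emod_lt_of_pos i (show 0 < n by omega)
    have hj' := Int.emod_lt_of_pos j (show 0 < n by omega)
    apply Int.dvd_of_emod_eq_zero
    rw [← Int.emod_eq_emod_iff_emod_sub_eq_zero]
    rcases lt_trichotomy (i % n) (j % n) with hlt | heq | hlt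
    · exact absurd hij (hinj _ _ hi hlt hj')
    · exact heq
    · exact absurd hij.symm (hinj _ _ hj hlt hi')
  · have hi := Int.emod_nonneg i (show n ≠ 0 by omega)
    have hi' := Int.emod_lt_of_pos i (show 0 < n by omega)
    have hs : (i + 1) % n = (i % n + 1) % n := by rw [Int.emod_add_emod]
    simp only [hs]
    by_cases hlt : i % n + 1 < n
    · rw [Int.emod_eq_of_lt (a := i % n + 1) (by omega) hlt]
      exact hadj _ hi hlt
    · have h1 : i % n = n - 1 := by omega
      rw [h1]
      simpa using hclose

/-- A chord cutting off a path of length three shortens a cycle by two. -/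
theorem exists_of_chord_three (h : IsCyclicSeq G n v) (hn : 6 ≤ n) {x : ℤ}
    (hx : G.Adj (v x) (v (x + 3))) : ∃ w, IsCyclicSeq G (n - 2) w := by
  refine (exists_of_range (f := fun t ↦ v (x + 3 + t)) (by omega) (fun i _ _ ↦ ?_) ?_
    fun i j h0 hij hj he ↦ ?_).imp fun _ hw ↦ hw.1
  · simpa [add_assoc] using h.adj_succ (x + 3 + i)
  · rw [h.eq_of_eq_add (i := x + 3 + (n - 2 - 1)) (j := x) (by ring)]
    simpa using hx
  · have := h.eq_of_eq he
    omega

/-- Two crossing chords that cut off exactly two vertices shorten a cycle by two. -/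
theorem exists_of_crossing_chords (h : IsCyclicSeq G n v) (hn : 6 ≤ n) {x y a b : ℤ} (ha : 0 < a)
    (hb : 0 < b) (hab : a + b = 4) (hxy : x + a < y) (hyx : y + b < x + n)
    (h1 : G.Adj (v x) (v y)) (h2 : G.Adj (v (x + a)) (v (y + b))) :
    ∃ w, IsCyclicSeq G (n - 2) w := by
  refine (exists_of_range
    (f := fun t ↦ if t ≤ y - x - a then v (y - t) else v (x + a + b + t - 1)) (by omega)
    (fun i _ _ ↦ ?_) ?_ fun i j h0 hij hj ↦ ?_).imp fun _ hw ↦ hw.1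
  · split_ifs with c1 c2 c3
    · have := (h.adj_succ (y - (i + 1))).symm
      rwa [sub_add_eq_add_sub, add_sub_add_right_eq_sub] at this
    · rw [show y - i = x + a by omega, show x + a + b + (i + 1) - 1 = y + b by omega]
      exact h2
    · omega
    · rw [show x + a + b + (i + 1) - 1 = x + a + b + i - 1 + 1 by ring]
      exact h.adj_succ _
  · rw [if_neg (by omega), if_pos (by omega),
      h.eq_of_eq_add (i := x + a + b + (n - 2 - 1) - 1) (j := x) (by omega), sub_zero]
    exact h1
  · split_ifs with c1 c2 c3 <;> intro he <;> have := h.eq_of_eq he <;> omega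

/-- Multiplying indices by three is a reparametrisation when `3 ∤ n`. -/
theorem triple (h : IsCyclicSeq G n v) (h3 : ¬ 3 ∣ n)
    (hH : ∀ i, H.Adj (v i) (v (i + 3))) : IsCyclicSeq H n fun i ↦ v (3 * i) where
  periodic i := h.eq_of_dvd ⟨3, by ring⟩
  dvd_of_eq i j hij := by
    have := h.dvd_of_eq _ _ hij
    rw [← mul_sub] at this
    have hc : IsCoprime n 3 :=
      ((Int.prime_three.coprime_iff_not_dvd).2 h3).symm
    exact hc.dvd_of_dvd_mul_left this
  adj_succ i := by rw [mul_add, mul_one]; exact hH _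

/-- If steps of size three of a cycle of `G` lie in `H` and `3` divides its length, then the three
cycles of `H` so obtained can be merged into one along two pairs of parallel chords of size five. -/
theorem exists_merge_three (h : IsCyclicSeq G n v) {k s : ℤ} (hn : n = 6 * k) (hk : 2 ≤ k)
    (hH : ∀ i, H.Adj (v i) (v (i + 3))) (hs : 0 ≤ s) (hsk : s ≤ 2 * k - 2)
    (h0 : H.Adj (v 0) (v 5)) (h3 : H.Adj (v 3) (v 8))
    (hj : H.Adj (v (8 + 3 * s)) (v (13 + 3 * s)))
    (hj3 : H.Adj (v (11 + 3 * s)) (v (16 + 3 * s))) :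
    ∃ w, IsCyclicSeq H n w ∧ (∀ t, 0 ≤ t → t < 2 * k → w t = v (3 + 3 * t)) ∧
      ∀ t, 0 ≤ t → t < 2 * k → w (4 * k - 1 - s + t) = v (16 + 3 * s + 3 * t) := by
  have hH' : ∀ i j, j = i + 3 ∨ i = j + 3 → H.Adj (v i) (v j) := by
    rintro i j (rfl | rfl)
    exacts [hH i, (hH j).symm]
  have hmod : ∀ i j, v i = v j → (3 : ℤ) ∣ i - j := fun i j hij ↦
    (show (3 : ℤ) ∣ n by omega).trans (h.dvd_of_eq i j hij)
  obtain ⟨w, hw, hwf⟩ := exists_of_range (G := H) (n := n) (f := fun t ↦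
    if t < 2 * k then v (3 + 3 * t)
    else if t < 4 * k - 1 - s then v (5 + n - 3 * (t - 2 * k))
    else if t < 6 * k - 1 - s then v (16 + 3 * s + 3 * (t - (4 * k - 1 - s)))
    else v (8 + 3 * s - 3 * (t - (6 * k - 1 - s)))) (by omega) (fun i _ _ ↦ by
      split_ifs
      any_goals first | omega | (refine hH' _ _ ?_; omega)
      · rw [h.eq_of_eq_add (i := 3 + 3 * i) (j := 0) (by omega),
          h.eq_of_eq_add (i := 5 + n - 3 * (i + 1 - 2 * k)) (j := 5) (by omega)]
        exact h0
      · rw [show 5 + n - 3 * (i - 2 * k) = 11 + 3 * s by omega,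
          show 16 + 3 * s + 3 * (i + 1 - (4 * k - 1 - s)) = 16 + 3 * s by omega]
        exact hj3
      · rw [h.eq_of_eq_add (i := 16 + 3 * s + 3 * (i - (4 * k - 1 - s))) (j := 13 + 3 * s)
            (by omega), show 8 + 3 * s - 3 * (i + 1 - (6 * k - 1 - s)) = 8 + 3 * s by omega]
        exact hj.symm) (by
      rw [if_neg (by omega), if_neg (by omega), if_neg (by omega), if_pos (by omega),
        show 8 + 3 * s - 3 * (n - 1 - (6 * k - 1 - s)) = 8 by omega]
      simpa using h3.symm) fun i j _ hij hj ↦ by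
      split_ifs <;> intro he <;> have e1 := h.eq_of_eq he <;> have e2 := hmod _ _ he <;> omega
  refine ⟨w, hw, fun t ht0 ht ↦ ?_, fun t ht0 ht ↦ ?_⟩
  · rw [hwf t ht0 (by omega), if_pos ht]
  · rw [hwf _ (by omega) (by omega), if_neg (by omega), if_neg (by omega), if_pos (by omega)]
    congr 1
    ring

/-- If steps of size three of a cycle of `G` lie in `H` and `3` divides its length, then the three
cycles of `H` so obtained can be merged, losing two vertices, along suitable chords. -/
theorem exists_merge_three_sub_two (h : IsCyclicSeq G n v) {k : ℤ} (hn : n = 6 * k) (hk : 2 ≤ k)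
    (hH : ∀ i, H.Adj (v i) (v (i + 3))) (h1 : H.Adj (v 1) (v 8)) (h2 : H.Adj (v 2) (v 7))
    (h7 : H.Adj (v 7) (v 12)) (h10 : H.Adj (v 10) (v 15)) :
    ∃ w, IsCyclicSeq H (n - 2) w := by
  have hH' : ∀ i j, j = i + 3 ∨ i = j + 3 → H.Adj (v i) (v j) := by
    rintro i j (rfl | rfl)
    exacts [hH i, (hH j).symm]
  have hmod : ∀ i j, v i = v j → (3 : ℤ) ∣ i - j := fun i j hij ↦
    (show (3 : ℤ) ∣ n by omega).trans (h.dvd_of_eq i j hij)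
  refine (exists_of_range (f := fun t ↦
    if t < 2 * k - 2 then v (10 + 3 * t)
    else if t < 4 * k - 3 then v (8 + 3 * (t - (2 * k - 2)))
    else if t < 4 * k - 2 then v 7
    else v (12 + n - 3 * (t - (4 * k - 2)))) (by omega) (fun i _ _ ↦ ?_) ?_
    fun i j h0 hij hj ↦ ?_).imp fun _ hw ↦ hw.1
  · split_ifs
    any_goals first | omega | (refine hH' _ _ ?_; omega)
    · rw [h.eq_of_eq_add (i := 10 + 3 * i) (j := 1) (by omega),
        show 8 + 3 * (i + 1 - (2 * k - 2)) = 8 by omega]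
      exact h1
    · rw [h.eq_of_eq_add (i := 8 + 3 * (i - (2 * k - 2))) (j := 2) (by omega)]
      exact h2
    · rw [h.eq_of_eq_add (i := 12 + n - 3 * (i + 1 - (4 * k - 2))) (j := 12) (by omega)]
      exact h7
  · rw [if_neg (by omega), if_neg (by omega), if_neg (by omega), if_pos (by omega),
      show 12 + n - 3 * (n - 2 - 1 - (4 * k - 2)) = 15 by omega]
    simpa using h10.symm
  · split_ifs <;> intro he <;> have e1 := h.eq_of_eq he <;> have e2 := hmod _ _ he <;> omega

/-- The two pairs of parallel chords of size five used in `exists_merge_three` cannot all be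
present when no cycle of length `n - 2` exists in either of the two colors. -/
theorem not_parallel_chords (h : IsCyclicSeq G n v) {k s : ℤ} (hn : n = 6 * k) (hk : 2 ≤ k)
    (hGH : ∀ i j, ¬ 2 ∣ i - j → G.Adj (v i) (v j) ∨ H.Adj (v i) (v j))
    (hG : ¬ ∃ w, IsCyclicSeq G (n - 2) w) (hH : ¬ ∃ w, IsCyclicSeq H (n - 2) w)
    (hH3 : ∀ i, H.Adj (v i) (v (i + 3))) (hs : 0 ≤ s) (hsk : s ≤ 2 * k - 2)
    (h0 : H.Adj (v 0) (v 5)) (h3 : H.Adj (v 3) (v 8))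
    (hj : H.Adj (v (8 + 3 * s)) (v (13 + 3 * s)))
    (hj3 : H.Adj (v (11 + 3 * s)) (v (16 + 3 * s))) : False := by
  obtain ⟨w, hw, hw1, hw2⟩ := h.exists_merge_three hn hk hH3 hs hsk h0 h3 hj hj3
  have hwH : ∀ t, ¬ H.Adj (w t) (w (t + 3)) := fun t ht ↦
    hH (hw.exists_of_chord_three (by omega) ht)
  have hG1 : ∀ i t, 0 ≤ t → t ≤ 2 * k - 4 → i = 3 + 3 * t → G.Adj (v i) (v (i + 9)) := by
    rintro i t ht0 ht rfl
    refine (hGH _ _ (by omega)).resolve_right fun ha ↦ hwH t ?_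
    rw [hw1 t ht0 (by omega), hw1 (t + 3) (by omega) (by omega)]
    rwa [mul_add, ← add_assoc]
  have hG2 : ∀ i t, 0 ≤ t → t ≤ 2 * k - 4 → i = 16 + 3 * s + 3 * t →
      G.Adj (v i) (v (i + 9)) := by
    rintro i t ht0 ht rfl
    refine (hGH _ _ (by omega)).resolve_right fun ha ↦ hwH (4 * k - 1 - s + t) ?_
    rw [hw2 t ht0 (by omega), add_assoc (4 * k - 1 - s), hw2 (t + 3) (by omega) (by omega)]
    rwa [mul_add, ← add_assoc]
  have hcross : ∀ i, 12 < n → G.Adj (v i) (v (i + 9)) → ¬ G.Adj (v (i + 2)) (v (i + 11)) :=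
    fun i hn ha hb ↦ hG <| h.exists_of_crossing_chords (by omega) (x := i) (y := i + 9)
      (a := 2) (b := 2) (by omega) (by omega) (by omega) (by omega) (by omega) ha
      (by rwa [add_assoc])
  have hper : ∀ i j, n ∣ i - j → G.Adj (v i) (v (i + 9)) → G.Adj (v j) (v (j + 9)) := by
    intro i j hij ha
    rwa [← h.eq_of_dvd hij, ← h.eq_of_dvd (i := i + 9) (j := j + 9) (by simpa using hij)]
  rcases (by omega : k = 2 ∨ k = 3 ∨ 4 ≤ k) with rfl | rfl | hk4
  · have := hH3 0
    refine hwH 0 ?_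
    rw [hw1 0 (by omega) (by omega), hw1 (0 + 3) (by omega) (by omega),
      h.eq_of_eq_add (i := 3 + 3 * (0 + 3)) (j := 0) (by omega)]
    exact this.symm
  · obtain rfl : n = 18 := by omega
    have hall : ∀ i, i = 3 ∨ i = 6 ∨ i = 9 ∨ i = 12 ∨ i = 15 ∨ i = 18 →
        G.Adj (v i) (v (i + 9)) := by
      rintro i hi
      rcases (by omega : i ≤ 9 ∨ 12 ≤ i) with hi9 | hi9
      · exact hG1 i ((i - 3) / 3) (by omega) (by omega) (by omega)
      · have := hG1 (i - 9) ((i - 12) / 3) (by omega) (by omega) (by omega)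
        rw [sub_add_cancel] at this
        rw [h.eq_of_eq_add (i := i + 9) (j := i - 9) (by omega)]
        exact this.symm
    refine hcross (16 + 3 * s) (by omega) (hG2 _ 0 (by omega) (by omega) (by omega)) ?_
    have := hper (if s = 0 then 18 else 3 * s) (16 + 3 * s + 2)
      (by split_ifs <;> omega) (hall _ (by split_ifs <;> omega))
    rwa [add_assoc _ 2 9] at this
  · obtain ⟨t, t', q, ht, ht1, ht', ht1', hq⟩ : ∃ t t' q : ℤ, 0 ≤ t ∧ t ≤ 2 * k - 4 ∧ 0 ≤ t' ∧
        t' ≤ 2 * k - 4 ∧ 3 + 3 * t - (16 + 3 * s + 3 * t' + 2) = 6 * k * q := by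
      rcases (by omega : 5 + s ≤ 2 * k - 4 ∨ 2 * k - 4 < 5 + s ∧ 5 + s < 2 * k ∨ 2 * k ≤ 5 + s)
        with hs | hs | hs
      · exact ⟨5 + s, 0, 0, by omega, by omega, by omega, by omega, by omega⟩
      · exact ⟨0, 2 * k - 5 - s, -1, by omega, by omega, by omega, by omega, by omega⟩
      · exact ⟨5 + s - 2 * k, 0, -1, by omega, by omega, by omega, by omega, by omega⟩
    refine hcross (16 + 3 * s + 3 * t') (by omega) (hG2 _ t' ht' ht1' rfl) ?_
    have := hper _ (16 + 3 * s + 3 * t' + 2) ⟨q, hn ▸ hq⟩ (hG1 _ t ht ht1 rfl)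
    rwa [add_assoc _ 2 9] at this

/-- A cycle of even length `n ≥ 12` divisible by three yields a cycle of length `n - 2` in one of
the two colors. -/
theorem exists_sub_two_of_three_dvd (h : IsCyclicSeq G n v) {k : ℤ} (hn : n = 6 * k) (hk : 2 ≤ k)
    (hGH : ∀ i j, ¬ 2 ∣ i - j → G.Adj (v i) (v j) ∨ H.Adj (v i) (v j)) :
    (∃ w, IsCyclicSeq G (n - 2) w) ∨ ∃ w, IsCyclicSeq H (n - 2) w := by
  by_contra! hno
  have hG : ¬ ∃ w, IsCyclicSeq G (n - 2) w := fun ⟨w, hw⟩ ↦ hno.1 w hw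
  have hH : ¬ ∃ w, IsCyclicSeq H (n - 2) w := fun ⟨w, hw⟩ ↦ hno.2 w hw
  clear hno
  have hH3 : ∀ i, H.Adj (v i) (v (i + 3)) := fun i ↦
    (hGH _ _ (by omega)).resolve_left fun ha ↦ hG (h.exists_of_chord_three (by omega) ha)
  obtain ⟨P, hP⟩ : ∃ P : ℤ → Prop, ∀ i, P i ↔ G.Adj (v i) (v (i + 5)) := ⟨_, fun _ ↦ Iff.rfl⟩
  have hP5 : ∀ i, ¬ P i → H.Adj (v i) (v (i + 5)) := fun i hi ↦
    (hGH _ _ (by omega)).resolve_left (mt (hP i).2 hi)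
  have hP2 : ∀ i, P i → ¬ P (i + 2) := by
    intro i hi hi2
    rw [hP] at hi hi2
    refine hG <| h.exists_of_crossing_chords (by omega) (x := i) (y := i + 5) (a := 2) (b := 2)
      (by omega) (by omega) (by omega) (by omega) (by omega) hi ?_
    rwa [add_right_comm]
  have hP7 : ∀ i, P i → H.Adj (v (i + 1)) (v (i + 8)) := by
    refine fun i hi ↦ (hGH _ _ (by omega)).resolve_left fun ha ↦ ?_
    refine hG <| h.exists_of_crossing_chords (by omega) (x := i) (y := i + 5) (a := 1) (b := 3)
      (by omega) (by omega) (by omega) (by omega) (by omega) ((hP i).1 hi) ?_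
    rwa [add_assoc i 5 3]
  have hpar : ∀ i j, ¬ P i → ¬ P (i + 3) → ¬ P j → ¬ P (j + 3) → 3 ∣ j - i - 2 →
      n ∣ j - (i + 5) := by
    intro i j hi hi3 hj hj3 hij
    by_contra hne
    have hr0 := Int.emod_nonneg (j - i - 8) (show n ≠ 0 by omega)
    have hr1 := Int.emod_lt_of_pos (j - i - 8) (show 0 < n by omega)
    have hrq := Int.emod_add_mul_ediv (j - i - 8) n
    have hr3 : (3 : ℤ) ∣ (j - i - 8) % n := by
      have : (3 : ℤ) ∣ n * ((j - i - 8) / n) := (show (3 : ℤ) ∣ n by omega).mul_right _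
      omega
    generalize hr : (j - i - 8) % n = r at hr0 hr1 hr3 hrq
    obtain ⟨s, rfl⟩ := hr3
    have hs : s ≠ 2 * k - 1 := by
      rintro rfl
      refine hne ⟨(j - i - 8) / n + 1, ?_⟩
      rw [mul_add]
      omega
    have hv : ∀ c d, d = 8 + 3 * s + c → v (i + d) = v (j + c) := fun c d hd ↦
      (h.eq_of_dvd ⟨(j - i - 8) / n, by omega⟩).symm
    refine (h.shift i).not_parallel_chords hn hk (fun a b hab ↦ hGH _ _ (by omega)) hG hH
      (fun a ↦ by rw [← add_assoc]; exact hH3 _) (s := s) (by omega) (by omega) ?_ ?_ ?_ ?_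
    · simpa using hP5 i hi
    · simpa [add_assoc] using hP5 _ hi3
    · rw [hv 0 (8 + 3 * s) (by ring), hv 5 (13 + 3 * s) (by ring), add_zero]
      exact hP5 j hj
    · rw [hv 3 (11 + 3 * s) (by ring), hv 8 (16 + 3 * s) (by ring)]
      simpa [add_assoc] using hP5 _ hj3
  have hper : ∀ i j, n ∣ i - j → P i → P j := by
    intro i j hij hi
    rw [hP] at hi ⊢
    rwa [← h.eq_of_dvd hij, ← h.eq_of_dvd (i := i + 5) (j := j + 5) (by simpa using hij)]
  have hP2' : ∀ i j, j = i + 2 → P i → P j → False := fun i j hij hi hj ↦ hP2 i hi (hij ▸ hj)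
  have hn6 : ∀ x, n ∣ x → (6 : ℤ) ∣ x := fun x hx ↦ (show (6 : ℤ) ∣ n by omega).trans hx
  by_cases hex : ∃ i j, ¬ P i ∧ ¬ P (i + 3) ∧ ¬ P j ∧ ¬ P (j + 3) ∧ 3 ∣ j - i - 2
  · obtain ⟨a, j, ha, ha3, hj, hj3, haj⟩ := hex
    have hdvd := hpar a j ha ha3 hj hj3 haj
    have ha5 : ¬ P (a + 5) := mt (hper _ _ (dvd_sub_comm.1 hdvd)) hj
    have ha8 : ¬ P (a + 8) := mt (hper _ _ (by
      rw [dvd_sub_comm, show j + 3 - (a + 8) = j - (a + 5) by ring]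
      exact hdvd)) hj3
    have ha5' : ¬ P (a + 5 + 3) := by rwa [add_assoc]
    have h11 : P (a + 8 + 3) := by
      by_contra hc
      have := hn6 _ (hpar a (a + 8) ha ha3 ha8 hc (by omega))
      omega
    have h12 : P (a + 9 + 3) := by
      by_contra hc
      have := hn6 _ (hpar (a + 9) (a + 5) (fun h9 ↦ hP2' _ _ (by ring) h9 h11) hc ha5 ha5'
        (by omega))
      omega
    have h10 : P (a + 10) := by
      by_contra hc
      have := hn6 _ (hpar (a + 10) a hc (fun h13 ↦ hP2' _ _ (by ring) h11 h13) ha ha3 (by omega))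
      omega
    exact hP2' _ _ (by ring) h10 h12
  · push Not at hex
    obtain ⟨b, hb⟩ : ∃ b, ∀ i, 3 ∣ i - b ∨ 3 ∣ i - b - 2 → ¬ P i → P (i + 3) := by
      by_cases hx : ∃ x, ¬ P x ∧ ¬ P (x + 3)
      · obtain ⟨x, hx, hx3⟩ := hx
        refine ⟨x - 1, fun i hi hi0 ↦ ?_⟩
        by_contra hi3
        rcases hi with hi | hi
        · exact hex x i hx hx3 hi0 hi3 (by omega)
        · exact hex i x hi0 hi3 hx hx3 (by omega)
      · push Not at hx
        exact ⟨0, fun i _ ↦ hx i⟩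
    obtain ⟨a, ha, hab⟩ : ∃ a, P a ∧ 3 ∣ a - b := by
      by_cases hPb : P b
      · exact ⟨b, hPb, by simp⟩
      · exact ⟨b + 3, hb b (by simp) hPb, by simp⟩
    have hstep : ∀ i j, j = i + 3 → (3 ∣ i - a ∨ 3 ∣ i - a - 2) → ¬ P i → P j :=
      fun i j hij hi hPi ↦ hij ▸ hb i (by omega) hPi
    have h2 : ¬ P (a + 2) := hP2 a ha
    have h5 : P (a + 5) := hstep (a + 2) _ (by ring) (by omega) h2
    have h7 : ¬ P (a + 7) := hP2' _ _ (by ring) h5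
    have h6 : P (a + 6) := hstep (a + 3) _ (by ring) (by omega)
      fun h3 ↦ hP2' _ _ (by ring) h3 h5
    have h11 : P (a + 11) := hstep (a + 8) _ (by ring) (by omega) (hP2' _ _ (by ring) h6)
    have h12 : P (a + 12) := hstep (a + 9) _ (by ring) (by omega)
      fun h9 ↦ hP2' _ _ (by ring) h9 h11
    have h10 : ¬ P (a + 10) := fun h10 ↦ hP2' _ _ (by ring) h10 h12
    refine hH <| (h.shift a).exists_merge_three_sub_two hn hk
      (fun i ↦ by rw [← add_assoc]; exact hH3 _) (hP7 a ha) ?_ ?_ ?_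
    · simpa [add_assoc] using hP5 _ h2
    · simpa [add_assoc] using hP5 _ h7
    · simpa [add_assoc] using hP5 _ h10

/-- In a two-coloring, a monochromatic cycle of even length `n ≥ 12` yields a monochromatic cycle
of length `n - 2`. -/
theorem exists_sub_two (h : IsCyclicSeq G n v) (hn : 12 ≤ n) (h2n : 2 ∣ n)
    (hGH : ∀ i j, ¬ 2 ∣ i - j → G.Adj (v i) (v j) ∨ H.Adj (v i) (v j)) :
    (∃ w, IsCyclicSeq G (n - 2) w) ∨ ∃ w, IsCyclicSeq H (n - 2) w := by
  by_cases h3n : 3 ∣ n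
  · exact h.exists_sub_two_of_three_dvd (k := n / 6) (by omega) (by omega) hGH
  by_contra! hno
  have hG : ¬ ∃ w, IsCyclicSeq G (n - 2) w := fun ⟨w, hw⟩ ↦ hno.1 w hw
  have hH3 : ∀ i, H.Adj (v i) (v (i + 3)) := fun i ↦
    (hGH _ _ (by omega)).resolve_left fun ha ↦ hG (h.exists_of_chord_three (by omega) ha)
  have hG9 : ∀ t, G.Adj (v (3 * t)) (v (3 * t + 9)) := by
    refine fun t ↦ (hGH _ _ (by omega)).resolve_right fun ha ↦ ?_
    obtain ⟨w, hw⟩ := (h.triple h3n hH3).exists_of_chord_three (by omega) (x := t)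
      (by rwa [mul_add])
    exact hno.2 w hw
  obtain ⟨t, q, ht⟩ : ∃ t q : ℤ, 3 * t - 2 = n * q := by
    rcases (by omega : n % 3 = 1 ∨ n % 3 = 2) with hr | hr
    · exact ⟨(n + 2) / 3, 1, by omega⟩
    · exact ⟨(2 * n + 2) / 3, 2, by omega⟩
  refine hG <| h.exists_of_crossing_chords (by omega) (x := 0) (y := 9) (a := 2) (b := 2)
    (by omega) (by omega) (by omega) (by omega) (by omega) (by simpa using hG9 0) ?_
  rw [← h.eq_of_dvd (i := 3 * t) (j := 0 + 2) ⟨q, by omega⟩,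
    ← h.eq_of_dvd (i := 3 * t + 9) (j := 9 + 2) ⟨q, by omega⟩]
  exact hG9 t

theorem hasCycleLength_iff {N : ℕ} (hN : 3 ≤ N) :
    hasCycleLength G N ↔ ∃ w, IsCyclicSeq G N w := by
  obtain ⟨N, rfl⟩ : ∃ M, N = M + 2 := ⟨N - 2, by omega⟩
  rw [hasCycleLength, ← SimpleGraph.cycleGraph_isContained_iff (by omega)]
  constructor
  · rintro ⟨f⟩
    have hmod : ∀ i : ℤ, (i % ((N + 2 : ℕ) : ℤ)).toNat < N + 2 := by
      intro i
      have := Int.emod_lt_of_pos i (show (0 : ℤ) < (N + 2 : ℕ) by omega)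
      omega
    refine (exists_of_range (n := (N + 2 : ℕ)) (f := fun i ↦ f ⟨_, hmod i⟩) (by omega)
      (fun i h0 h1 ↦ f.toHom.map_adj ?_) (f.toHom.map_adj ?_) fun i j h0 hij hj he ↦ ?_).imp
      fun _ hw ↦ hw.1
    · rw [SimpleGraph.cycleGraph_adj']
      right
      rw [Fin.sub_val_of_le] <;> simp only [Fin.mk_le_mk] <;>
        rw [Int.emod_eq_of_lt (a := i) (by omega) (by omega), Int.emod_eq_of_lt (by omega) h1] <;>
        omega
    · rw [SimpleGraph.cycleGraph_adj]
      right
      rw [sub_eq_iff_eq_add, Fin.ext_iff]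
      simp only [Fin.val_add, Fin.val_one, Int.emod_eq_of_lt (a := ((N + 2 : ℕ) : ℤ) - 1)
        (b := (N + 2 : ℕ)) (by omega) (by omega), Int.zero_emod]
      rw [show 1 + (((N + 2 : ℕ) : ℤ) - 1).toNat = N + 2 by omega, Nat.mod_self, Int.toNat_zero]
    · have := f.injective he
      rw [Fin.mk.injEq, Int.emod_eq_of_lt (by omega) (by omega), Int.emod_eq_of_lt (by omega) hj]
        at this
      omega
  · rintro ⟨w, hw⟩
    refine ⟨⟨⟨fun i ↦ w i.val, fun {i j} hij ↦ ?_⟩, fun i j hij ↦ ?_⟩⟩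
    · have hs : ∀ i j : Fin (N + 2), i - j = 1 → G.Adj (w j.val) (w i.val) := by
        intro i j hij
        obtain rfl : i = j + 1 := by rw [← hij]; simp
        rw [hw.eq_of_dvd (i := ((j + 1 : Fin (N + 2)).val : ℤ)) (j := (j.val : ℤ) + 1) ?_]
        · exact hw.adj_succ _
        · rw [Fin.val_add_eq_ite]
          rw [Fin.val_one]
          split_ifs
          · exact ⟨-1, by omega⟩
          · exact ⟨0, by omega⟩
      rcases SimpleGraph.cycleGraph_adj.1 hij with h | h
      · exact (hs _ _ h).symm
      · exact hs _ _ h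
    · exact Fin.ext (by exact_mod_cast hw.eq_of_eq hij (by omega) (by omega))

variable {α β : Type*} {G H : SimpleGraph (α ⊕ β)} {v : ℤ → α ⊕ β}

theorem isLeft_eq_iff (h : IsCyclicSeq G n v) (hG : G ≤ completeBipartiteGraph α β) (i j : ℤ) :
    (v i).isLeft = (v j).isLeft ↔ 2 ∣ i - j := by
  have hs : ∀ i, (v (i + 1)).isLeft = !(v i).isLeft := by
    intro i
    have := hG (h.adj_succ i)
    revert this
    cases v i <;> cases v (i + 1) <;> simp
  obtain ⟨k, rfl⟩ : ∃ k, i = j + k := ⟨i - j, by ring⟩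
  rw [add_sub_cancel_left]
  induction k using Int.induction_on with
  | zero => simp
  | succ k ih =>
    rw [← add_assoc, hs, (by omega : (2 : ℤ) ∣ k + 1 ↔ ¬ 2 ∣ (k : ℤ))]
    refine Iff.trans ?_ (not_congr ih)
    grind
  | pred k ih =>
    have := hs (j + (-k - 1))
    rw [add_assoc, sub_add_cancel] at this
    rw [(by omega : (2 : ℤ) ∣ -k - 1 ↔ ¬ 2 ∣ (-k : ℤ))]
    refine Iff.trans ?_ (not_congr ih)
    grind

theorem two_dvd (h : IsCyclicSeq G n v) (hG : G ≤ completeBipartiteGraph α β) : 2 ∣ n := by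
  have := (h.isLeft_eq_iff hG n 0).1 (by rw [← h.periodic 0, zero_add])
  simpa using this

theorem adj_or_adj (h : IsCyclicSeq G n v) (hG : G ≤ completeBipartiteGraph α β)
    (hGH : completeBipartiteGraph α β ≤ G ⊔ H) (i j : ℤ) (hij : ¬ 2 ∣ i - j) :
    G.Adj (v i) (v j) ∨ H.Adj (v i) (v j) := by
  refine hGH ?_
  rw [← h.isLeft_eq_iff hG] at hij
  revert hij
  cases v i <;> cases v j <;> simp

/-- In a two-colored complete bipartite graph, a monochromatic cycle of length `2 * c` yields
monochromatic cycles of every even length between `10` and `2 * c`. -/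
theorem exists_of_le (hG : G ≤ completeBipartiteGraph α β) (hH : H ≤ completeBipartiteGraph α β)
    (hGH : completeBipartiteGraph α β ≤ G ⊔ H) {m c : ℤ} (hm : 5 ≤ m) (hmc : m ≤ c)
    (h : (∃ w, IsCyclicSeq G (2 * c) w) ∨ ∃ w, IsCyclicSeq H (2 * c) w) :
    (∃ w, IsCyclicSeq G (2 * m) w) ∨ ∃ w, IsCyclicSeq H (2 * m) w := by
  induction c, hmc using Int.leInduction with
  | base => exact h
  | succ c hc ih =>
    refine ih ?_
    rw [show 2 * c = 2 * (c + 1) - 2 by ring]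
    rcases h with ⟨w, hw⟩ | ⟨w, hw⟩
    · exact hw.exists_sub_two (by omega) (by simp) (hw.adj_or_adj hG hGH)
    · exact (hw.exists_sub_two (by omega) (by simp)
        (hw.adj_or_adj hH (by rwa [sup_comm]))).symm

end IsCyclicSeq

theorem hasCycleLength_le {α β : Type*} {G H : SimpleGraph (α ⊕ β)}
    (hG : G ≤ completeBipartiteGraph α β) (hH : H ≤ completeBipartiteGraph α β)
    (hGH : completeBipartiteGraph α β ≤ G ⊔ H) {m l : ℕ} (hm : 5 ≤ m)
    (hGm : ¬ hasCycleLength G (2 * m)) (hHm : ¬ hasCycleLength H (2 * m))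
    (hl : hasCycleLength G l) : l ≤ 2 * (m - 1) := by
  by_contra! hlt
  rw [IsCyclicSeq.hasCycleLength_iff (by omega)] at hGm hHm hl
  push_cast at hGm hHm
  obtain ⟨w, hw⟩ := hl
  obtain ⟨c, hc⟩ := hw.two_dvd hG
  rw [hc] at hw
  rcases IsCyclicSeq.exists_of_le hG hH hGH (m := m) (c := c) (by omega) (by omega)
    (.inl ⟨w, hw⟩) with h | h
  exacts [hGm h, hHm h]

/-- For `m ≥ 5`, if a red/blue coloring of `K_{2m, 2m}` contains no monochromatic
`C_{2m}`, then every red cycle and every blue cycle has length at most `2(m-1)`. -/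
theorem diag_longest_cycle_bound (m : ℕ) (hm : 5 ≤ m)
    (red : SimpleGraph (Fin (2 * m) ⊕ Fin (2 * m)))
    (hred : red ≤ completeBipartiteGraph (Fin (2 * m)) (Fin (2 * m)))
    (hnored : ¬ hasCycleLength red (2 * m))
    (hnoblue :
      ¬ hasCycleLength (completeBipartiteGraph (Fin (2 * m)) (Fin (2 * m)) \ red) (2 * m)) :
    (∀ l : ℕ, hasCycleLength red l → l ≤ 2 * (m - 1)) ∧
    (∀ l : ℕ,
      hasCycleLength (completeBipartiteGraph (Fin (2 * m)) (Fin (2 * m)) \ red) l →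
        l ≤ 2 * (m - 1)) := by
  have hle : completeBipartiteGraph (Fin (2 * m)) (Fin (2 * m)) ≤
      red ⊔ (completeBipartiteGraph (Fin (2 * m)) (Fin (2 * m)) \ red) := by
    rw [sup_sdiff_self_right]
    exact le_sup_right
  exact ⟨fun _ hl ↦ hasCycleLength_le hred sdiff_le hle hm hnored hnoblue hl,
    fun _ hl ↦ hasCycleLength_le sdiff_le hred (by rwa [sup_comm]) hm hnoblue hnored hl⟩
end
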